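/- Let 1 ≤ p₃ ≤ ∞, 1 < p₁, p₂ < ∞, and let m be a bilinear multiplier of type (p₁,p₂,p₃). For every rectangle Q = [a,b] × [c,d] ⊂ ℝ², the truncated symbol m·χ_Q is a bilinear multiplier of type (p₁,p₂,p₃), and there is a constant C depending only on p₁ and p₂ such that ‖m χ_Q‖_{(p₁,p₂,p₃)} ≤ C ‖m‖_{(p₁,p₂,p₃)}. -/

import Mathlib

open MeasureTheory Set ENNReal

noncomputable def FT (f : ℝ → ℂ) (ξ : ℝ) : ℂ :=
  ∫ x : ℝ, Complex.exp (-(2 * Real.pi * x * ξ) * Complex.I) * f x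

noncomputable def FT2 (Φ : ℝ × ℝ → ℂ) (ξη : ℝ × ℝ) : ℂ :=
  ∫ uv : ℝ × ℝ, Complex.exp (-(2 * Real.pi * (ξη.1 * uv.1 + ξη.2 * uv.2)) * Complex.I) * Φ uv

/-- The class `𝒫(ℝ)`: Schwartz functions whose Fourier transform has compact support. -/
def MemP (f : ℝ → ℂ) : Prop :=
  (∃ φ : SchwartzMap ℝ ℂ, ⇑φ = f) ∧ HasCompactSupport (FT f)

/-- The bilinear operator associated to a symbol `m` on `ℝ × ℝ`. -/
noncomputable def Bm (m : ℝ × ℝ → ℂ) (f g : ℝ → ℂ) (x : ℝ) : ℂ :=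
  ∫ ξη : ℝ × ℝ, FT f ξη.1 * FT g ξη.2 * m ξη *
    Complex.exp ((2 * Real.pi * (ξη.1 + ξη.2) * x) * Complex.I)

/-- `m` is a bilinear multiplier of type `(p₁, p₂, p₃)`. -/
def IsBiMult (p₁ p₂ p₃ : ℝ≥0∞) (m : ℝ × ℝ → ℂ) : Prop :=
  ∃ C : ℝ, 0 < C ∧ ∀ f g : ℝ → ℂ, MemP f → MemP g →
    eLpNorm (Bm m f g) p₃ volume ≤
      ENNReal.ofReal C * eLpNorm f p₁ volume * eLpNorm g p₂ volume

/-- The multiplier norm `‖m‖_{(p₁,p₂,p₃)}`: the least admissible constant. -/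
noncomputable def biNorm (p₁ p₂ p₃ : ℝ≥0∞) (m : ℝ × ℝ → ℂ) : ℝ :=
  sInf {C : ℝ | 0 ≤ C ∧ ∀ f g : ℝ → ℂ, MemP f → MemP g →
    eLpNorm (Bm m f g) p₃ volume ≤
      ENNReal.ofReal C * eLpNorm f p₁ volume * eLpNorm g p₂ volume}

open Filter Topology

theorem exists_taylor_bounds {Φ : ℂ → ℝ} (hΦ : ContDiff ℝ 2 Φ) (h0 : Φ 0 = 0)
    (h0' : fderiv ℝ Φ 0 = 0) (M : ℝ) :
    ∃ B : ℝ, 0 ≤ B ∧ ∀ z : ℂ, ‖z‖ ≤ M → |Φ z| ≤ B * ‖z‖ ^ 2 ∧ ‖fderiv ℝ Φ z‖ ≤ B * ‖z‖ ∧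
      ‖fderiv ℝ (fderiv ℝ Φ) z‖ ≤ B := by
  have hD1 : ContDiff ℝ 1 (fderiv ℝ Φ) := hΦ.fderiv_right (by norm_num)
  have hD2 : Continuous (fderiv ℝ (fderiv ℝ Φ)) := hD1.continuous_fderiv (by norm_num)
  have hn : Continuous (fun z => ‖fderiv ℝ (fderiv ℝ Φ) z‖) :=
    (continuous_norm (E := ℂ →L[ℝ] ℂ →L[ℝ] ℝ)).comp hD2
  obtain ⟨B, hB⟩ := (isCompact_closedBall (0 : ℂ) M).bddAbove_image hn.continuousOn
  have hBB : ∀ z : ℂ, ‖z‖ ≤ M → ‖fderiv ℝ (fderiv ℝ Φ) z‖ ≤ max B 0 := fun z hz =>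
    (hB ⟨z, by simpa using hz, rfl⟩).trans (le_max_left _ _)
  have hB1 : ∀ z : ℂ, ‖z‖ ≤ M → ‖fderiv ℝ Φ z‖ ≤ max B 0 * ‖z‖ := fun z hz => by
    have := (convex_closedBall (0 : ℂ) M).norm_image_sub_le_of_norm_fderiv_le (𝕜 := ℝ)
      (f := fderiv ℝ Φ) (x := 0) (y := z) (C := max B 0)
      (fun x _ => (hD1.differentiable (by norm_num)) x)
      (fun x hx => hBB x (by simpa using hx)) (by simpa using (norm_nonneg z).trans hz)
      (by simpa using hz)
    simpa [h0'] using this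
  refine ⟨max B 0, le_max_right _ _, fun z hz => ⟨?_, hB1 z hz, hBB z hz⟩⟩
  have := (convex_closedBall (0 : ℂ) ‖z‖).norm_image_sub_le_of_norm_fderiv_le (𝕜 := ℝ)
      (f := Φ) (x := 0) (y := z) (C := max B 0 * ‖z‖)
      (fun x _ => (hΦ.differentiable (by norm_num)) x)
      (fun x hx => (hB1 x (le_trans (by simpa using hx) hz)).trans
        (by gcongr; simpa using hx)) (by simp) (by simp)
  simpa [h0, pow_two, mul_assoc] using this

theorem inv_one_add_norm_sq_le {C : ℝ} (z : ℂ) :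
    (C / (1 + ‖z‖)) ^ 2 ≤ C ^ 2 * (1 + z.re ^ 2)⁻¹ := by
  rw [div_pow, div_eq_mul_inv]
  gcongr
  have := Complex.abs_re_le_norm z
  have h2 : z.re ^ 2 ≤ ‖z‖ ^ 2 := by
    rw [← sq_abs z.re]; gcongr
  nlinarith [norm_nonneg z]

theorem bilin_add_bilin_I_nonneg (L : ℂ →L[ℝ] ℂ →L[ℝ] ℝ) (h : 0 ≤ L 1 1 + L Complex.I Complex.I)
    (w : ℂ) : 0 ≤ L (Complex.I * w) (Complex.I * w) + L w w := by
  have e1 : w = w.re • (1 : ℂ) + w.im • Complex.I := by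
    apply Complex.ext <;> simp
  have e2 : Complex.I * w = w.re • Complex.I - w.im • (1 : ℂ) := by
    apply Complex.ext <;> simp
  have : L (Complex.I * w) (Complex.I * w) + L w w =
      (w.re ^ 2 + w.im ^ 2) * (L 1 1 + L Complex.I Complex.I) := by
    rw [e2]
    nth_rw 5 6 [e1]
    simp only [map_add, map_sub, map_smul, add_apply,
      sub_apply, smul_apply, smul_eq_mul]
    ring
  rw [this]; positivity

theorem integral_comp_nonneg_of_subharmonic {Φ : ℂ → ℝ} (hΦ : ContDiff ℝ 2 Φ) (h0 : Φ 0 = 0)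
    (h0' : fderiv ℝ Φ 0 = 0)
    (hΔ : ∀ z, 0 ≤ fderiv ℝ (fderiv ℝ Φ) z 1 1 + fderiv ℝ (fderiv ℝ Φ) z Complex.I Complex.I)
    {F F₁ F₂ : ℂ → ℂ} (hF : ∀ z, HasDerivAt F (F₁ z) z) (hF₁ : ∀ z, HasDerivAt F₁ (F₂ z) z)
    (hF₂ : Continuous F₂) {C : ℝ} (hb : ∀ z : ℂ, -1 ≤ z.im → ‖F z‖ ≤ C / (1 + ‖z‖))
    (hb₁ : ∀ z : ℂ, -1 ≤ z.im → ‖F₁ z‖ ≤ C / (1 + ‖z‖))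
    (hb₂ : ∀ z : ℂ, -1 ≤ z.im → ‖F₂ z‖ ≤ C / (1 + ‖z‖)) :
    0 ≤ ∫ x : ℝ, Φ (F x) := by
  have hD1 : ContDiff ℝ 1 (fderiv ℝ Φ) := hΦ.fderiv_right (by norm_num)
  have hD1c : Continuous (fderiv ℝ Φ) := hD1.continuous
  have hD2 : Continuous (fderiv ℝ (fderiv ℝ Φ)) := hD1.continuous_fderiv (by norm_num)
  have hFc : Continuous F := continuous_iff_continuousAt.2 fun z => (hF z).continuousAt
  have hFc₁ : Continuous F₁ := continuous_iff_continuousAt.2 fun z => (hF₁ z).continuousAt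
  have hΦc := hΦ.continuous
  obtain ⟨B, hB0, hB⟩ := exists_taylor_bounds hΦ h0 h0' C
  have hC : 0 ≤ C := by
    have := (norm_nonneg _).trans (hb 0 (by simp))
    simpa using this
  have hFC : ∀ z : ℂ, -1 ≤ z.im → ‖F z‖ ≤ C := fun z hz =>
    (hb z hz).trans (div_le_self hC (by linarith [norm_nonneg z]))
  set P : ℝ → ℝ → ℂ := fun t x => (x : ℂ) + t * Complex.I with hP
  have hPim : ∀ t x, (P t x).im = t := fun t x => by simp [hP]
  have hPre : ∀ t x, (P t x).re = x := fun t x => by simp [hP]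
  have hPc : ∀ t, Continuous (P t) := fun t => by fun_prop
  set v : ℝ → ℝ → ℝ := fun t x => Φ (F (P t x)) with hv
  set v₁ : ℝ → ℝ → ℝ := fun t x => fderiv ℝ Φ (F (P t x)) (Complex.I * F₁ (P t x)) with hv₁
  set v₂ : ℝ → ℝ → ℝ := fun t x =>
    fderiv ℝ (fderiv ℝ Φ) (F (P t x)) (Complex.I * F₁ (P t x)) (Complex.I * F₁ (P t x)) +
      fderiv ℝ Φ (F (P t x)) (-F₂ (P t x)) with hv₂
  set w₁ : ℝ → ℝ → ℝ := fun t x => fderiv ℝ Φ (F (P t x)) (F₁ (P t x)) with hw₁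
  set w₂ : ℝ → ℝ → ℝ := fun t x =>
    fderiv ℝ (fderiv ℝ Φ) (F (P t x)) (F₁ (P t x)) (F₁ (P t x)) +
      fderiv ℝ Φ (F (P t x)) (F₂ (P t x)) with hw₂
  have vc : ∀ t, Continuous (v t) := fun t => by fun_prop
  have v₁c : ∀ t, Continuous (v₁ t) := fun t => by fun_prop
  have v₂c : ∀ t, Continuous (v₂ t) := fun t => by fun_prop
  have w₁c : ∀ t, Continuous (w₁ t) := fun t => by fun_prop
  have w₂c : ∀ t, Continuous (w₂ t) := fun t => by fun_prop
  have hdt : ∀ t x, HasDerivAt (fun s => P s x) Complex.I t := fun t x => by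
    simpa [hP] using ((hasDerivAt_id t).ofReal_comp.mul_const Complex.I).const_add (x : ℂ)
  have hdx : ∀ t x, HasDerivAt (fun s => P t s) 1 x := fun t x => by
    simpa [hP] using (hasDerivAt_id x).ofReal_comp.add_const ((t : ℂ) * Complex.I)
  have hΦd : ∀ z, HasFDerivAt Φ (fderiv ℝ Φ z) z := fun z =>
    (hΦ.differentiable (by norm_num) z).hasFDerivAt
  have hΦd' : ∀ z, HasFDerivAt (fderiv ℝ Φ) (fderiv ℝ (fderiv ℝ Φ) z) z := fun z =>
    (hD1.differentiable (by norm_num) z).hasFDerivAt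
  have dFt : ∀ t x, HasDerivAt (fun s => F (P s x)) (Complex.I * F₁ (P t x)) t := fun t x => by
    rw [mul_comm]; exact (hF (P t x)).comp t (hdt t x)
  have dFx : ∀ t x, HasDerivAt (fun s => F (P t s)) (F₁ (P t x)) x := fun t x => by
    simpa [Function.comp_def] using (hF (P t x)).comp x (hdx t x)
  have dF₁t : ∀ t x, HasDerivAt (fun s => Complex.I * F₁ (P s x)) (-F₂ (P t x)) t := fun t x => by
    have := ((hF₁ (P t x)).comp t (hdt t x)).const_mul Complex.I
    convert! this using 1
    linear_combination F₂ (P t x) * Complex.I_sq.symm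
  have dF₁x : ∀ t x, HasDerivAt (fun s => F₁ (P t s)) (F₂ (P t x)) x := fun t x => by
    simpa [Function.comp_def] using (hF₁ (P t x)).comp x (hdx t x)
  have dvt : ∀ t x, HasDerivAt (fun s => v s x) (v₁ t x) t := fun t x =>
    (hΦd _).comp_hasDerivAt t (dFt t x)
  have dv₁t : ∀ t x, HasDerivAt (fun s => v₁ s x) (v₂ t x) t := fun t x =>
    ((hΦd' _).comp_hasDerivAt t (dFt t x)).clm_apply (dF₁t t x)
  have dw₁x : ∀ t x, HasDerivAt (fun s => w₁ t s) (w₂ t x) x := fun t x =>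
    ((hΦd' _).comp_hasDerivAt x (dFx t x)).clm_apply (dF₁x t x)
  set K : ℝ := 2 * B * (1 + C) * C ^ 2 with hK
  have hq : ∀ t x, (C / (1 + ‖P t x‖)) ^ 2 ≤ C ^ 2 * (1 + x ^ 2)⁻¹ := fun t x => by
    have := inv_one_add_norm_sq_le (C := C) (P t x)
    rwa [hPre] at this
  have hKi : Integrable (fun x : ℝ => K * (1 + x ^ 2)⁻¹) := integrable_inv_one_add_sq.const_mul K
  have hKq : ∀ t x, 2 * B * (1 + C) * (C / (1 + ‖P t x‖)) ^ 2 ≤ K * (1 + x ^ 2)⁻¹ := fun t x => by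
    rw [hK, mul_assoc _ (C ^ 2)]
    exact mul_le_mul_of_nonneg_left (hq t x) (by positivity)
  have hlin : ∀ t x, -1 < t → ∀ u : ℂ, ‖u‖ ≤ C / (1 + ‖P t x‖) →
      ‖fderiv ℝ Φ (F (P t x)) u‖ ≤ B * (C / (1 + ‖P t x‖)) ^ 2 := fun t x ht u hu => by
    have ht' : -1 ≤ (P t x).im := by rw [hPim]; exact ht.le
    refine (ContinuousLinearMap.le_opNorm _ _).trans ?_
    have h1 := (hB _ (hFC _ ht')).2.1
    calc _ ≤ (B * ‖F (P t x)‖) * ‖u‖ := by gcongr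
      _ ≤ (B * (C / (1 + ‖P t x‖))) * (C / (1 + ‖P t x‖)) := by gcongr; exact hb _ ht'
      _ = _ := by ring
  have hquad : ∀ t x, -1 < t → ∀ u : ℂ, ‖u‖ ≤ C / (1 + ‖P t x‖) →
      ‖fderiv ℝ (fderiv ℝ Φ) (F (P t x)) u u‖ ≤ B * (C / (1 + ‖P t x‖)) ^ 2 := fun t x ht u hu => by
    have ht' : -1 ≤ (P t x).im := by rw [hPim]; exact ht.le
    refine (ContinuousLinearMap.le_opNorm₂ _ _ _).trans ?_
    have h1 := (hB _ (hFC _ ht')).2.2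
    calc _ ≤ B * (C / (1 + ‖P t x‖)) * (C / (1 + ‖P t x‖)) := by gcongr
      _ = _ := by ring
  have hIF : ∀ t x, -1 < t → ‖Complex.I * F₁ (P t x)‖ ≤ C / (1 + ‖P t x‖) := fun t x ht => by
    simpa using hb₁ (P t x) (by rw [hPim]; exact ht.le)
  have hF1' : ∀ t x, -1 < t → ‖F₁ (P t x)‖ ≤ C / (1 + ‖P t x‖) := fun t x ht =>
    hb₁ (P t x) (by rw [hPim]; exact ht.le)
  have hF2' : ∀ t x, -1 < t → ‖F₂ (P t x)‖ ≤ C / (1 + ‖P t x‖) := fun t x ht =>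
    hb₂ (P t x) (by rw [hPim]; exact ht.le)
  have hS : ∀ t x, 0 ≤ B * (C / (1 + ‖P t x‖)) ^ 2 ∧ 0 ≤ B * C * (C / (1 + ‖P t x‖)) ^ 2 :=
    fun t x => ⟨by positivity, by positivity⟩
  have bv : ∀ t x, -1 < t → ‖v t x‖ ≤ B * C ^ 2 / (1 + ‖P t x‖) ^ 2 := fun t x ht => by
    have ht' : -1 ≤ (P t x).im := by rw [hPim]; exact ht.le
    have h1 := (hB _ (hFC _ ht')).1
    calc _ ≤ B * ‖F (P t x)‖ ^ 2 := h1
      _ ≤ B * (C / (1 + ‖P t x‖)) ^ 2 := by gcongr; exact hb _ ht'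
      _ = _ := by rw [div_pow]; ring
  have bvK : ∀ t x, -1 < t → ‖v t x‖ ≤ K * (1 + x ^ 2)⁻¹ := fun t x ht => by
    have := bv t x ht
    rw [mul_div_assoc, ← div_pow] at this
    linarith [hKq t x, hS t x]
  have bv₁ : ∀ t x, -1 < t → ‖v₁ t x‖ ≤ K * (1 + x ^ 2)⁻¹ := fun t x ht => by
    linarith [hKq t x, hS t x, hlin t x ht _ (hIF t x ht)]
  have bw₁ : ∀ t x, -1 < t → ‖w₁ t x‖ ≤ K * (1 + x ^ 2)⁻¹ := fun t x ht => by
    linarith [hKq t x, hS t x, hlin t x ht _ (hF1' t x ht)]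
  have bv₂ : ∀ t x, -1 < t → ‖v₂ t x‖ ≤ K * (1 + x ^ 2)⁻¹ := fun t x ht => by
    refine (norm_add_le _ _).trans ?_
    have := hlin t x ht (-F₂ (P t x)) (by simpa using hF2' t x ht)
    linarith [hKq t x, hS t x, hquad t x ht _ (hIF t x ht)]
  have bw₂ : ∀ t x, -1 < t → ‖w₂ t x‖ ≤ K * (1 + x ^ 2)⁻¹ := fun t x ht => by
    refine (norm_add_le _ _).trans ?_
    have := hlin t x ht (F₂ (P t x)) (hF2' t x ht)
    linarith [hKq t x, hS t x, hquad t x ht _ (hF1' t x ht)]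
  have hint : ∀ {f : ℝ → ℝ}, Continuous f → (∀ x, ‖f x‖ ≤ K * (1 + x ^ 2)⁻¹) → Integrable f :=
    fun hf hle => hKi.mono' hf.aestronglyMeasurable (ae_of_all _ hle)
  have dI : ∀ t, -1 < t → HasDerivAt (fun s => ∫ x, v s x) (∫ x, v₁ t x) t := fun t ht =>
    (hasDerivAt_integral_of_dominated_loc_of_deriv_le (Ioi_mem_nhds ht)
      (Eventually.of_forall fun s => (vc s).aestronglyMeasurable)
      (hint (vc t) fun x => bvK t x ht) (v₁c t).aestronglyMeasurable
      (ae_of_all _ fun x s hs => bv₁ s x hs) hKi (ae_of_all _ fun x s _ => dvt s x)).2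
  have dI₁ : ∀ t, -1 < t → HasDerivAt (fun s => ∫ x, v₁ s x) (∫ x, v₂ t x) t := fun t ht =>
    (hasDerivAt_integral_of_dominated_loc_of_deriv_le (Ioi_mem_nhds ht)
      (Eventually.of_forall fun s => (v₁c s).aestronglyMeasurable)
      (hint (v₁c t) fun x => bv₁ t x ht) (v₂c t).aestronglyMeasurable
      (ae_of_all _ fun x s hs => bv₂ s x hs) hKi (ae_of_all _ fun x s _ => dv₁t s x)).2
  have hI2 : ∀ t, -1 < t → 0 ≤ ∫ x, v₂ t x := fun t ht => by
    have hw : ∫ x, w₂ t x = 0 := integral_eq_zero_of_hasDerivAt_of_integrable (dw₁x t)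
      (hint (w₂c t) fun x => bw₂ t x ht) (hint (w₁c t) fun x => bw₁ t x ht)
    have e : ∫ x, v₂ t x = ∫ x, (v₂ t x + w₂ t x) := by
      rw [integral_add (hint (v₂c t) fun x => bv₂ t x ht) (hint (w₂c t) fun x => bw₂ t x ht), hw,
        add_zero]
    rw [e]
    refine integral_nonneg fun x => ?_
    have := bilin_add_bilin_I_nonneg (fderiv ℝ (fderiv ℝ Φ) (F (P t x))) (hΔ _) (F₁ (P t x))
    simp only [hv₂, hw₂, map_neg, Pi.zero_apply]
    linarith
  have hconv : ConvexOn ℝ (Ioi (-1 : ℝ)) (fun s => ∫ x, v s x) :=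
    convexOn_of_hasDerivWithinAt2_nonneg (convex_Ioi _)
      (fun t ht => (dI t ht).continuousAt.continuousWithinAt)
      (fun t ht => (dI t (by simpa using ht)).hasDerivWithinAt)
      (fun t ht => (dI₁ t (by simpa using ht)).hasDerivWithinAt)
      (fun t ht => hI2 t (by simpa using ht))
  have hlim : Tendsto (fun s => ∫ x, v s x) atTop (𝓝 0) := by
    rw [← integral_zero ℝ ℝ]
    refine tendsto_integral_filter_of_dominated_convergence _
      (Eventually.of_forall fun s => (vc s).aestronglyMeasurable) ?_ hKi ?_
    · filter_upwards [eventually_gt_atTop (-1)] with t ht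
      exact ae_of_all _ fun x => bvK t x ht
    · refine ae_of_all _ fun x => squeeze_zero_norm'
        (a := fun t : ℝ => B * C ^ 2 / (1 + t) ^ 2) ?_ ?_
      · filter_upwards [eventually_ge_atTop 0] with t ht
        refine (bv t x (by linarith)).trans ?_
        have := Complex.abs_im_le_norm (P t x)
        rw [hPim, abs_of_nonneg ht] at this
        gcongr
      · refine Tendsto.const_div_atTop ?_ _
        exact (tendsto_pow_atTop two_ne_zero).comp (tendsto_atTop_add_const_left _ _ tendsto_id)
  have key : ∀ h : ℝ, 0 ≤ h → ∫ x, v h x ≤ (1/2) * (∫ x, v 0 x) + (1/2) * ∫ x, v (2 * h) x :=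
    fun h hh => by
      obtain ⟨-, hc⟩ := hconv
      have := hc (show (0 : ℝ) ∈ Ioi (-1) by simp) (show 2 * h ∈ Ioi (-1) by simp; linarith)
        (a := 1 / 2) (b := 1 / 2) (by norm_num) (by norm_num) (by norm_num)
      simpa using this
  have hlim2 : Tendsto (fun h => (1/2) * (∫ x, v 0 x) + (1/2) * ∫ x, v (2 * h) x) atTop
      (𝓝 ((1/2) * (∫ x, v 0 x) + (1/2) * 0)) :=
    ((hlim.comp (tendsto_id.const_mul_atTop (by norm_num : (0:ℝ) < 2))).const_mul _).const_add _
  have := le_of_tendsto_of_tendsto hlim hlim2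
    (by filter_upwards [eventually_ge_atTop 0] with h hh using key h hh)
  have e : ∀ x : ℝ, P 0 x = x := fun x => by simp [hP]
  simp only [hv, e] at this
  linarith

theorem fderiv_apply_eq_of_hasDerivAt {Φ : ℂ → ℝ} (hΦ : ContDiff ℝ 2 Φ) {e : ℂ} {g h : ℂ → ℝ}
    (hg : ∀ z, HasDerivAt (fun s : ℝ => Φ (z + s • e)) (g z) 0)
    (hh : ∀ z, HasDerivAt (fun s : ℝ => g (z + s • e)) (h z) 0) (z : ℂ) :
    fderiv ℝ Φ z e = g z ∧ fderiv ℝ (fderiv ℝ Φ) z e e = h z := by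
  have hl : ∀ z : ℂ, HasDerivAt (fun s : ℝ => z + s • e) e 0 := fun z => by
    simpa using ((hasDerivAt_id (0 : ℝ)).smul_const e).const_add z
  have h1 : ∀ z, fderiv ℝ Φ z e = g z := fun z => by
    have := HasFDerivAt.comp_hasDerivAt (f := fun s : ℝ => z + s • e) (l := Φ)
      (l' := fderiv ℝ Φ z) 0
      (by simpa using (hΦ.differentiable (by norm_num) z).hasFDerivAt) (hl z)
    exact this.unique (hg z)
  refine ⟨h1 z, ?_⟩
  have hD1 : ContDiff ℝ 1 (fderiv ℝ Φ) := hΦ.fderiv_right (by norm_num)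
  have := HasFDerivAt.comp_hasDerivAt (f := fun s : ℝ => z + s • e) (l := fderiv ℝ Φ)
      (l' := fderiv ℝ (fderiv ℝ Φ) z) 0
      (by simpa using (hD1.differentiable (by norm_num) z).hasFDerivAt) (hl z)
  have h2 := this.clm_apply (hasDerivAt_const 0 e)
  simp only [map_zero, add_zero, Function.comp_apply, h1] at h2
  exact h2.unique (hh z)

theorem hasDerivAt_const_add_sq (a b : ℝ) :
    HasDerivAt (fun s : ℝ => (a + s) ^ 2 + b) (2 * a) 0 := by
  simpa using (((hasDerivAt_id (0 : ℝ)).const_add a).pow 2).add_const b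

theorem hasDerivAt_const_add_sq_rpow (a : ℝ) {b : ℝ} (hb : 0 < b) (r : ℝ) :
    HasDerivAt (fun s : ℝ => ((a + s) ^ 2 + b) ^ r) (2 * a * r * (a ^ 2 + b) ^ (r - 1)) 0 := by
  have := (hasDerivAt_const_add_sq a b).rpow_const (p := r) (Or.inl (by positivity))
  simpa using this

/-- Hypotheses of the sub-mean-value argument: `Φ` vanishes to second order at the origin and is
subharmonic. -/
def IsSubharmonicFlat (Φ : ℂ → ℝ) : Prop :=
  ContDiff ℝ 2 Φ ∧ Φ 0 = 0 ∧ fderiv ℝ Φ 0 = 0 ∧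
    ∀ z, 0 ≤ fderiv ℝ (fderiv ℝ Φ) z 1 1 + fderiv ℝ (fderiv ℝ Φ) z Complex.I Complex.I

theorem IsSubharmonicFlat.of_partial {Φ : ℂ → ℝ} (hΦ : ContDiff ℝ 2 Φ) (h0 : Φ 0 = 0)
    {g₁ h₁ g₂ h₂ : ℂ → ℝ}
    (hg₁ : ∀ z, HasDerivAt (fun s : ℝ => Φ (z + s • (1 : ℂ))) (g₁ z) 0)
    (hh₁ : ∀ z, HasDerivAt (fun s : ℝ => g₁ (z + s • (1 : ℂ))) (h₁ z) 0)
    (hg₂ : ∀ z, HasDerivAt (fun s : ℝ => Φ (z + s • Complex.I)) (g₂ z) 0)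
    (hh₂ : ∀ z, HasDerivAt (fun s : ℝ => g₂ (z + s • Complex.I)) (h₂ z) 0)
    (hz₁ : g₁ 0 = 0) (hz₂ : g₂ 0 = 0) (hΔ : ∀ z, 0 ≤ h₁ z + h₂ z) : IsSubharmonicFlat Φ := by
  refine ⟨hΦ, h0, ?_, fun z => ?_⟩
  · ext w
    have e1 : w = w.re • (1 : ℂ) + w.im • Complex.I := by
      apply Complex.ext <;> simp
    rw [e1, map_add, map_smul, map_smul, (fderiv_apply_eq_of_hasDerivAt hΦ hg₁ hh₁ 0).1,
      (fderiv_apply_eq_of_hasDerivAt hΦ hg₂ hh₂ 0).1, hz₁, hz₂]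
    simp
  · rw [(fderiv_apply_eq_of_hasDerivAt hΦ hg₁ hh₁ z).2,
      (fderiv_apply_eq_of_hasDerivAt hΦ hg₂ hh₂ z).2]
    exact hΔ z

theorem contDiff_complex_re : ContDiff ℝ 2 (fun z : ℂ => z.re) := Complex.reCLM.contDiff

theorem contDiff_complex_im : ContDiff ℝ 2 (fun z : ℂ => z.im) := Complex.imCLM.contDiff

theorem isSubharmonicFlat_of_le_one {r c δ : ℝ} (hr : 1 / 2 < r) (hr' : r ≤ 1)
    (hc : c * (2 * r - 1) = 2) (hδ : 0 < δ) :
    IsSubharmonicFlat (fun z => c * ((z.re ^ 2 + δ) ^ r - δ ^ r) -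
      ((z.re ^ 2 + z.im ^ 2 + δ) ^ r - δ ^ r)) := by
  have hc0 : 0 < c := by
    by_contra! h
    nlinarith
  refine IsSubharmonicFlat.of_partial
    (g₁ := fun z => c * (2 * z.re * r * (z.re ^ 2 + δ) ^ (r - 1)) -
      2 * z.re * r * (z.re ^ 2 + z.im ^ 2 + δ) ^ (r - 1))
    (h₁ := fun z => c * (2 * r * (z.re ^ 2 + δ) ^ (r - 1) +
        2 * z.re * r * (2 * z.re * (r - 1) * (z.re ^ 2 + δ) ^ (r - 1 - 1))) -
      (2 * r * (z.re ^ 2 + z.im ^ 2 + δ) ^ (r - 1) +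
        2 * z.re * r * (2 * z.re * (r - 1) * (z.re ^ 2 + z.im ^ 2 + δ) ^ (r - 1 - 1))))
    (g₂ := fun z => -(2 * z.im * r * (z.re ^ 2 + z.im ^ 2 + δ) ^ (r - 1)))
    (h₂ := fun z => -(2 * r * (z.re ^ 2 + z.im ^ 2 + δ) ^ (r - 1) +
        2 * z.im * r * (2 * z.im * (r - 1) * (z.re ^ 2 + z.im ^ 2 + δ) ^ (r - 1 - 1))))
    ?_ ?_ ?_ ?_ ?_ ?_ ?_ ?_ ?_
  · refine (contDiff_const.mul (ContDiff.sub (ContDiff.rpow_const_of_ne ?_ ?_) contDiff_const)).sub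
      (ContDiff.sub (ContDiff.rpow_const_of_ne ?_ ?_) contDiff_const)
    · exact (contDiff_complex_re.pow 2).add contDiff_const
    · intro z; positivity
    · exact ((contDiff_complex_re.pow 2).add (contDiff_complex_im.pow 2)).add contDiff_const
    · intro z; positivity
  · simp
  · intro z
    have h1 := hasDerivAt_const_add_sq_rpow z.re hδ r
    have h2 := hasDerivAt_const_add_sq_rpow z.re (b := z.im ^ 2 + δ) (by positivity) r
    simpa [add_assoc] using ((h1.sub_const (δ ^ r)).const_mul c).fun_sub (h2.sub_const (δ ^ r))
  · intro z
    have h1 := hasDerivAt_const_add_sq_rpow z.re hδ (r - 1)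
    have h2 := hasDerivAt_const_add_sq_rpow z.re (b := z.im ^ 2 + δ) (by positivity) (r - 1)
    have h3 : HasDerivAt (fun s : ℝ => 2 * (z.re + s) * r) (2 * r) 0 := by
      simpa using (((hasDerivAt_id (0 : ℝ)).const_add z.re).const_mul 2).mul_const r
    simpa [add_assoc] using ((h3.fun_mul h1).const_mul c).fun_sub (h3.fun_mul h2)
  · intro z
    have h2 := hasDerivAt_const_add_sq_rpow z.im (b := z.re ^ 2 + δ) (by positivity) r
    have := (h2.sub_const (δ ^ r)).const_sub (c * ((z.re ^ 2 + δ) ^ r - δ ^ r))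
    simpa [add_assoc, add_left_comm] using this
  · intro z
    have h2 := hasDerivAt_const_add_sq_rpow z.im (b := z.re ^ 2 + δ) (by positivity) (r - 1)
    have h3 : HasDerivAt (fun s : ℝ => 2 * (z.im + s) * r) (2 * r) 0 := by
      simpa using (((hasDerivAt_id (0 : ℝ)).const_add z.im).const_mul 2).mul_const r
    simpa [add_assoc, add_left_comm] using (h3.fun_mul h2).fun_neg
  · simp
  · simp
  · intro z
    set a := z.re
    set b := z.im
    have hN : 0 < a ^ 2 + δ := by positivity
    have hD : 0 < a ^ 2 + b ^ 2 + δ := by positivity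
    have eN : (a ^ 2 + δ) ^ (r - 1) = (a ^ 2 + δ) ^ (r - 1 - 1) * (a ^ 2 + δ) := by
      rw [← Real.rpow_add_one hN.ne']; congr 1; ring
    have hND : (a ^ 2 + b ^ 2 + δ) ^ (r - 1) ≤ (a ^ 2 + δ) ^ (r - 1) :=
      Real.rpow_le_rpow_of_nonpos hN (by nlinarith) (by linarith)
    have hn : 0 < (a ^ 2 + δ) ^ (r - 1 - 1) := Real.rpow_pos_of_pos hN _
    have hd : 0 < (a ^ 2 + b ^ 2 + δ) ^ (r - 1 - 1) := Real.rpow_pos_of_pos hD _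
    have k1 : 4 * r * (a ^ 2 + δ) ^ (r - 1) ≤ c * (2 * r * (a ^ 2 + δ) ^ (r - 1) +
        2 * a * r * (2 * a * (r - 1) * (a ^ 2 + δ) ^ (r - 1 - 1))) := by
      have : c * (2 * r * (a ^ 2 + δ) ^ (r - 1) +
        2 * a * r * (2 * a * (r - 1) * (a ^ 2 + δ) ^ (r - 1 - 1))) -
          4 * r * (a ^ 2 + δ) ^ (r - 1) =
          4 * r * c * δ * (1 - r) * (a ^ 2 + δ) ^ (r - 1 - 1) := by
        rw [eN]
        linear_combination 2 * r * (a ^ 2 + δ) ^ (r - 1 - 1) * (a ^ 2 + δ) * hc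
      have h2 : 0 ≤ 4 * r * c * δ * (1 - r) * (a ^ 2 + δ) ^ (r - 1 - 1) := by
        have : 0 ≤ 1 - r := by linarith
        positivity
      linarith
    have k2 : 0 ≤ 4 * r * (1 - r) * (a ^ 2 + b ^ 2) * (a ^ 2 + b ^ 2 + δ) ^ (r - 1 - 1) := by
      have : 0 ≤ 1 - r := by linarith
      positivity
    have k3 : r * (a ^ 2 + b ^ 2 + δ) ^ (r - 1) ≤ r * (a ^ 2 + δ) ^ (r - 1) := by gcongr
    linarith

theorem isSubharmonicFlat_of_nonneg {s α δ : ℝ} (hs : 0 ≤ s) (hα : α = 1 + 6 * s + 2 * s ^ 2)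
    (hδ : 0 < δ) :
    IsSubharmonicFlat (fun z => (α * z.re ^ 2 - z.im ^ 2) * (z.re ^ 2 + z.im ^ 2 + δ) ^ s) := by
  refine IsSubharmonicFlat.of_partial
    (g₁ := fun z => 2 * α * z.re * (z.re ^ 2 + z.im ^ 2 + δ) ^ s +
      (α * z.re ^ 2 - z.im ^ 2) * (2 * z.re * s * (z.re ^ 2 + z.im ^ 2 + δ) ^ (s - 1)))
    (h₁ := fun z => 2 * α * (z.re ^ 2 + z.im ^ 2 + δ) ^ s +
      2 * α * z.re * (2 * z.re * s * (z.re ^ 2 + z.im ^ 2 + δ) ^ (s - 1)) +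
      (2 * α * z.re * (2 * z.re * s * (z.re ^ 2 + z.im ^ 2 + δ) ^ (s - 1)) +
      (α * z.re ^ 2 - z.im ^ 2) * (2 * s * (z.re ^ 2 + z.im ^ 2 + δ) ^ (s - 1) +
        2 * z.re * s * (2 * z.re * (s - 1) * (z.re ^ 2 + z.im ^ 2 + δ) ^ (s - 1 - 1)))))
    (g₂ := fun z => -2 * z.im * (z.re ^ 2 + z.im ^ 2 + δ) ^ s +
      (α * z.re ^ 2 - z.im ^ 2) * (2 * z.im * s * (z.re ^ 2 + z.im ^ 2 + δ) ^ (s - 1)))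
    (h₂ := fun z => -2 * (z.re ^ 2 + z.im ^ 2 + δ) ^ s +
      -2 * z.im * (2 * z.im * s * (z.re ^ 2 + z.im ^ 2 + δ) ^ (s - 1)) +
      (-2 * z.im * (2 * z.im * s * (z.re ^ 2 + z.im ^ 2 + δ) ^ (s - 1)) +
      (α * z.re ^ 2 - z.im ^ 2) * (2 * s * (z.re ^ 2 + z.im ^ 2 + δ) ^ (s - 1) +
        2 * z.im * s * (2 * z.im * (s - 1) * (z.re ^ 2 + z.im ^ 2 + δ) ^ (s - 1 - 1)))))
    ?_ ?_ ?_ ?_ ?_ ?_ ?_ ?_ ?_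
  · refine ((contDiff_const.mul (contDiff_complex_re.pow 2)).sub (contDiff_complex_im.pow 2)).mul
      (ContDiff.rpow_const_of_ne ?_ ?_)
    · exact ((contDiff_complex_re.pow 2).add (contDiff_complex_im.pow 2)).add contDiff_const
    · intro z; positivity
  · simp
  · intro z
    have h2 := hasDerivAt_const_add_sq_rpow z.re (b := z.im ^ 2 + δ) (by positivity) s
    have h3 : HasDerivAt (fun s : ℝ => α * (z.re + s) ^ 2 - z.im ^ 2) (2 * α * z.re) 0 := by
      have := ((hasDerivAt_const_add_sq z.re 0).const_mul α).sub_const (z.im ^ 2)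
      convert! this using 1
      · simp
      · ring
    simpa [add_assoc] using h3.fun_mul h2
  · intro z
    have h2 := hasDerivAt_const_add_sq_rpow z.re (b := z.im ^ 2 + δ) (by positivity) s
    have h4 := hasDerivAt_const_add_sq_rpow z.re (b := z.im ^ 2 + δ) (by positivity) (s - 1)
    have h3 : HasDerivAt (fun s : ℝ => α * (z.re + s) ^ 2 - z.im ^ 2) (2 * α * z.re) 0 := by
      have := ((hasDerivAt_const_add_sq z.re 0).const_mul α).sub_const (z.im ^ 2)
      convert! this using 1
      · simp
      · ring
    have h5 : HasDerivAt (fun t : ℝ => 2 * (z.re + t) * s) (2 * s) 0 := by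
      simpa using (((hasDerivAt_id (0 : ℝ)).const_add z.re).const_mul 2).mul_const s
    have h6 : HasDerivAt (fun t : ℝ => 2 * α * (z.re + t)) (2 * α) 0 := by
      simpa using (((hasDerivAt_id (0 : ℝ)).const_add z.re).const_mul (2 * α))
    simpa [add_assoc] using (h6.fun_mul h2).fun_add (h3.fun_mul (h5.fun_mul h4))
  · intro z
    have h2 := hasDerivAt_const_add_sq_rpow z.im (b := z.re ^ 2 + δ) (by positivity) s
    have h3 : HasDerivAt (fun s : ℝ => α * z.re ^ 2 - (z.im + s) ^ 2) (-2 * z.im) 0 := by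
      have := ((hasDerivAt_const_add_sq z.im 0).const_sub (α * z.re ^ 2))
      convert! this using 1
      · simp
      · ring
    simpa [add_assoc, add_left_comm] using h3.fun_mul h2
  · intro z
    have h2 := hasDerivAt_const_add_sq_rpow z.im (b := z.re ^ 2 + δ) (by positivity) s
    have h4 := hasDerivAt_const_add_sq_rpow z.im (b := z.re ^ 2 + δ) (by positivity) (s - 1)
    have h3 : HasDerivAt (fun s : ℝ => α * z.re ^ 2 - (z.im + s) ^ 2) (-2 * z.im) 0 := by
      have := ((hasDerivAt_const_add_sq z.im 0).const_sub (α * z.re ^ 2))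
      convert! this using 1
      · simp
      · ring
    have h5 : HasDerivAt (fun t : ℝ => 2 * (z.im + t) * s) (2 * s) 0 := by
      simpa using (((hasDerivAt_id (0 : ℝ)).const_add z.im).const_mul 2).mul_const s
    have h6 : HasDerivAt (fun t : ℝ => -2 * (z.im + t)) (-2) 0 := by
      simpa using (((hasDerivAt_id (0 : ℝ)).const_add z.im).const_mul (-2))
    simpa [add_assoc, add_left_comm] using (h6.fun_mul h2).fun_add (h3.fun_mul (h5.fun_mul h4))
  · simp
  · simp
  · intro z
    set a := z.re
    set b := z.im
    have hD : 0 < a ^ 2 + b ^ 2 + δ := by positivity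
    have e1 : (a ^ 2 + b ^ 2 + δ) ^ (s - 1) =
        (a ^ 2 + b ^ 2 + δ) ^ (s - 1 - 1) * (a ^ 2 + b ^ 2 + δ) := by
      rw [← Real.rpow_add_one hD.ne']; congr 1; ring
    have e2 : (a ^ 2 + b ^ 2 + δ) ^ s =
        (a ^ 2 + b ^ 2 + δ) ^ (s - 1 - 1) * (a ^ 2 + b ^ 2 + δ) ^ 2 := by
      rw [pow_two (a ^ 2 + b ^ 2 + δ), ← mul_assoc, ← e1, ← Real.rpow_add_one hD.ne']; congr 1; ring
    have hd : 0 < (a ^ 2 + b ^ 2 + δ) ^ (s - 1 - 1) := Real.rpow_pos_of_pos hD _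
    rw [e2, e1]
    set d := (a ^ 2 + b ^ 2 + δ) ^ (s - 1 - 1)
    have hα0 : 0 ≤ α := by rw [hα]; positivity
    have key : 0 ≤ d * (4 * s * (3 * δ * (a ^ 2 + b ^ 2 + δ) + 2 * a ^ 2 * (a ^ 2 + b ^ 2 + δ) +
          a ^ 2 * (a ^ 2 + b ^ 2 + δ)) +
        4 * s ^ 2 * ((a ^ 2 + b ^ 2 + δ) ^ 2 - b ^ 2 * (a ^ 2 + b ^ 2)) +
        4 * s * b ^ 2 * (a ^ 2 + b ^ 2) +
        α * a ^ 2 * s * (12 * δ + 8 * (a ^ 2 + b ^ 2)) + 4 * α * a ^ 2 * s ^ 2 * (a ^ 2 + b ^ 2)) := by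
      have : 0 ≤ (a ^ 2 + b ^ 2 + δ) ^ 2 - b ^ 2 * (a ^ 2 + b ^ 2) := by
        nlinarith [mul_nonneg (sq_nonneg a) (sq_nonneg b), mul_nonneg (sq_nonneg a) hδ.le,
          mul_nonneg (sq_nonneg b) hδ.le, sq_nonneg (a ^ 2), sq_nonneg δ]
      positivity
    refine key.trans_eq ?_
    rw [hα]; ring

/-- An entire function which, together with its first two derivatives, is `O(1 / (1 + |z|))` on the
half plane `-1 ≤ Im z`. -/
def IsDecayingEntire (F : ℂ → ℂ) : Prop :=
  ∃ (F₁ F₂ : ℂ → ℂ) (C : ℝ), (∀ z, HasDerivAt F (F₁ z) z) ∧ (∀ z, HasDerivAt F₁ (F₂ z) z) ∧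
    Continuous F₂ ∧ ∀ z : ℂ, -1 ≤ z.im → ‖F z‖ ≤ C / (1 + ‖z‖) ∧ ‖F₁ z‖ ≤ C / (1 + ‖z‖) ∧
      ‖F₂ z‖ ≤ C / (1 + ‖z‖)

namespace IsDecayingEntire

variable {F : ℂ → ℂ}

theorem continuous (hF : IsDecayingEntire F) : Continuous fun x : ℝ => F x := by
  obtain ⟨F₁, F₂, C, h, -⟩ := hF
  have : Continuous F := continuous_iff_continuousAt.2 fun z => (h z).continuousAt
  fun_prop

theorem exists_bound (hF : IsDecayingEntire F) : ∃ C : ℝ, 0 ≤ C ∧ ∀ x : ℝ,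
    ‖F x‖ ≤ C * (1 + ‖x‖)⁻¹ ∧ ‖F x‖ ≤ C := by
  obtain ⟨F₁, F₂, C, -, -, -, h⟩ := hF
  have hC : 0 ≤ C := by
    have := (norm_nonneg _).trans (h 0 (by simp)).1
    simpa using this
  refine ⟨C, hC, fun x => ?_⟩
  have := (h x (by simp)).1
  rw [Complex.norm_real] at this
  exact ⟨by rwa [← div_eq_mul_inv], this.trans (div_le_self hC (by linarith [norm_nonneg x]))⟩

theorem integrable_norm_rpow (hF : IsDecayingEntire F) {p : ℝ} (hp : 1 < p) :
    Integrable fun x : ℝ => ‖F x‖ ^ p := by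
  obtain ⟨C, hC, h⟩ := hF.exists_bound
  have hi : Integrable fun x : ℝ => C ^ p * (1 + ‖x‖) ^ (-p) :=
    (integrable_one_add_norm (by simpa using hp)).const_mul _
  refine hi.mono' ((hF.continuous.norm.rpow_const
    fun x => Or.inr (by linarith)).aestronglyMeasurable) (ae_of_all _ fun x => ?_)
  have h0 : 0 ≤ 1 + ‖x‖ := by positivity
  rw [Real.norm_of_nonneg (by positivity), Real.rpow_neg h0, ← Real.inv_rpow h0,
    ← Real.mul_rpow hC (by positivity)]
  exact Real.rpow_le_rpow (norm_nonneg _) (h x).1 (by linarith)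

theorem integrable_re_rpow (hF : IsDecayingEntire F) {p : ℝ} (hp : 1 < p) :
    Integrable fun x : ℝ => |(F x).re| ^ p := by
  refine (hF.integrable_norm_rpow hp).mono' ((Complex.continuous_re.comp
    hF.continuous).abs.rpow_const fun x => Or.inr (by linarith)).aestronglyMeasurable
    (ae_of_all _ fun x => ?_)
  rw [Real.norm_of_nonneg (by positivity)]
  exact Real.rpow_le_rpow (abs_nonneg _) (Complex.abs_re_le_norm _) (by linarith)

theorem integral_nonneg_of_tendsto (hF : IsDecayingEntire F) {Φ : ℝ → ℂ → ℝ} {Ψ : ℂ → ℝ}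
    (hΦ : ∀ δ, 0 < δ → IsSubharmonicFlat (Φ δ)) {p : ℝ} (hp : 1 < p)
    (hK : ∀ M, ∃ K, ∀ δ, 0 < δ → δ ≤ 1 → ∀ z : ℂ, ‖z‖ ≤ M → |Φ δ z| ≤ K * ‖z‖ ^ p)
    (hlim : ∀ z, Tendsto (fun δ => Φ δ z) (𝓝[>] 0) (𝓝 (Ψ z))) :
    0 ≤ ∫ x : ℝ, Ψ (F x) := by
  obtain ⟨M, -, hM⟩ := hF.exists_bound
  obtain ⟨K, hK⟩ := hK M
  have h1 : ∀ᶠ δ : ℝ in 𝓝[>] 0, 0 < δ := eventually_mem_nhdsWithin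
  have h2 : ∀ᶠ δ : ℝ in 𝓝[>] 0, δ ≤ 1 :=
    eventually_nhdsWithin_of_eventually_nhds (eventually_le_nhds one_pos)
  have := tendsto_integral_filter_of_dominated_convergence (μ := volume) (l := 𝓝[>] (0 : ℝ))
    (F := fun δ (x : ℝ) => Φ δ (F x)) (f := fun x : ℝ => Ψ (F x)) (fun x : ℝ => K * ‖F x‖ ^ p)
    (by
      filter_upwards [h1] with δ hδ
      exact ((hΦ δ hδ).1.continuous.comp hF.continuous).aestronglyMeasurable)
    (by
      filter_upwards [h1, h2] with δ hδ hδ'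
      exact ae_of_all _ fun x => hK δ hδ hδ' _ (hM x).2)
    ((hF.integrable_norm_rpow hp).const_mul K) (ae_of_all _ fun x => hlim _)
  refine ge_of_tendsto this ?_
  filter_upwards [h1] with δ hδ
  obtain ⟨F₁, F₂, C, hd, hd₁, hc, hb⟩ := hF
  obtain ⟨ha, hb', hc', hd'⟩ := hΦ δ hδ
  exact integral_comp_nonneg_of_subharmonic ha hb' hc' hd' hd hd₁ hc (fun z hz => (hb z hz).1)
    (fun z hz => (hb z hz).2.1) (fun z hz => (hb z hz).2.2)

theorem integral_rpow_le_of_pointwise (hF : IsDecayingEntire F) {p : ℝ} (hp : 1 < p) {Ψ : ℂ → ℝ}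
    (h0 : 0 ≤ ∫ x : ℝ, Ψ (F x)) {K c : ℝ} (hc : 0 < c)
    (hΨ : ∀ z, Ψ z ≤ K * |z.re| ^ p - c * ‖z‖ ^ p)
    (hΨK : ∃ K', ∀ z, |Ψ z| ≤ K' * ‖z‖ ^ p) (hΨc : Continuous Ψ) :
    ∫ x : ℝ, ‖F x‖ ^ p ≤ K / c * ∫ x : ℝ, |(F x).re| ^ p := by
  obtain ⟨K', hK'⟩ := hΨK
  have hi1 := hF.integrable_norm_rpow hp
  have hi2 := hF.integrable_re_rpow hp
  have hi : Integrable fun x : ℝ => Ψ (F x) :=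
    (hi1.const_mul K').mono' (hΨc.comp hF.continuous).aestronglyMeasurable
      (ae_of_all _ fun x => hK' _)
  have := integral_mono hi ((hi2.const_mul K).sub (hi1.const_mul c)) fun x => hΨ (F x)
  simp only [Pi.sub_apply] at this
  rw [integral_sub (hi2.const_mul K) (hi1.const_mul c), integral_const_mul,
    integral_const_mul] at this
  rw [div_mul_eq_mul_div, le_div_iff₀ hc]
  linarith

theorem norm_rpow_eq (z : ℂ) (p : ℝ) : ‖z‖ ^ p = (z.re ^ 2 + z.im ^ 2) ^ (p / 2) := by
  have : z.re ^ 2 + z.im ^ 2 = ‖z‖ ^ (2 : ℝ) := by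
    rw [Real.rpow_two, Complex.sq_norm, Complex.normSq_apply]; ring
  rw [this, ← Real.rpow_mul (norm_nonneg _)]
  congr 1; ring

theorem abs_re_rpow_eq (z : ℂ) (p : ℝ) : |z.re| ^ p = (z.re ^ 2) ^ (p / 2) := by
  have : z.re ^ 2 = |z.re| ^ (2 : ℝ) := by
    rw [Real.rpow_two, sq_abs]
  rw [this, ← Real.rpow_mul (abs_nonneg _)]
  congr 1; ring

theorem tendsto_add_rpow (t : ℝ) {r : ℝ} (hr : 0 ≤ r) :
    Tendsto (fun δ : ℝ => (t + δ) ^ r) (𝓝[>] 0) (𝓝 (t ^ r)) := by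
  have h : Continuous fun δ : ℝ => (t + δ) ^ r :=
    Continuous.rpow_const (by fun_prop) fun x => Or.inr hr
  simpa using h.continuousWithinAt.tendsto (x := (0 : ℝ)) (s := Ioi 0)

theorem integral_rpow_le_of_le_two (hF : IsDecayingEntire F) {p : ℝ} (hp : 1 < p) (hp2 : p ≤ 2) :
    ∫ x : ℝ, ‖F x‖ ^ p ≤ 2 / (p - 1) * ∫ x : ℝ, |(F x).re| ^ p := by
  set c := 2 / (p - 1) with hc
  have hc0 : 0 < c := div_pos two_pos (by linarith)
  have hr0 : (0 : ℝ) ≤ p / 2 := by linarith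
  have hsub : ∀ t δ : ℝ, 0 ≤ t → 0 < δ →
      0 ≤ (t + δ) ^ (p / 2) - δ ^ (p / 2) ∧ (t + δ) ^ (p / 2) - δ ^ (p / 2) ≤ t ^ (p / 2) :=
    fun t δ ht hδ => by
      have h1 := Real.rpow_add_le_add_rpow ht hδ.le hr0 (by linarith)
      have h2 : δ ^ (p / 2) ≤ (t + δ) ^ (p / 2) := Real.rpow_le_rpow hδ.le (by linarith) hr0
      constructor <;> linarith
  have hb : ∀ z : ℂ, |z.re| ^ p ≤ ‖z‖ ^ p := fun z =>
    Real.rpow_le_rpow (abs_nonneg _) (Complex.abs_re_le_norm _) (by linarith)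
  have h0 := hF.integral_nonneg_of_tendsto (p := p)
    (Φ := fun δ z => c * ((z.re ^ 2 + δ) ^ (p / 2) - δ ^ (p / 2)) -
      ((z.re ^ 2 + z.im ^ 2 + δ) ^ (p / 2) - δ ^ (p / 2)))
    (Ψ := fun z => c * |z.re| ^ p - ‖z‖ ^ p)
    (fun δ hδ => isSubharmonicFlat_of_le_one (by linarith) (by linarith)
      (by rw [hc]; field_simp [show p - 1 ≠ 0 by linarith]) hδ) hp
    (fun M => ⟨c + 1, fun δ hδ _ z _ => by
      obtain ⟨h1, h2⟩ := hsub (z.re ^ 2) δ (by positivity) hδ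
      obtain ⟨h3, h4⟩ := hsub (z.re ^ 2 + z.im ^ 2) δ (by positivity) hδ
      rw [← norm_rpow_eq] at h4
      rw [← abs_re_rpow_eq] at h2
      have h5 : c * ((z.re ^ 2 + δ) ^ (p / 2) - δ ^ (p / 2)) ≤ c * ‖z‖ ^ p := by
        gcongr; exact h2.trans (hb z)
      have h6 : 0 ≤ c * ((z.re ^ 2 + δ) ^ (p / 2) - δ ^ (p / 2)) := by positivity
      have h7 : 0 ≤ ‖z‖ ^ p := by positivity
      have h8 : 0 ≤ c * ‖z‖ ^ p := by positivity
      rw [abs_le]; constructor <;> linarith⟩)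
    (fun z => by
      have hz := tendsto_add_rpow 0 hr0
      simp only [zero_add] at hz
      rw [Real.zero_rpow (by linarith)] at hz
      simp only [norm_rpow_eq, abs_re_rpow_eq]
      simpa using (((tendsto_add_rpow (z.re ^ 2) hr0).sub hz).const_mul c).sub
        ((tendsto_add_rpow (z.re ^ 2 + z.im ^ 2) hr0).sub hz))
  have := hF.integral_rpow_le_of_pointwise hp h0 (K := c) (c := 1) one_pos
    (fun z => by rw [one_mul])
    ⟨c + 1, fun z => by
      have h1 : 0 ≤ |z.re| ^ p := by positivity
      have h2 : c * |z.re| ^ p ≤ c * ‖z‖ ^ p := by gcongr; exact Complex.abs_re_le_norm _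
      have h3 : 0 ≤ c * |z.re| ^ p := by positivity
      have h7 : 0 ≤ ‖z‖ ^ p := by positivity
      rw [abs_le]; constructor <;> linarith⟩
    (by
      refine (continuous_const.mul (Complex.continuous_re.abs.rpow_const
        fun x => Or.inr (by linarith))).sub (continuous_norm.rpow_const
        fun x => Or.inr (by linarith)))
  simpa using this

theorem mul_rpow_le_of_two_le {p : ℝ} (hp : 2 ≤ p) {α : ℝ} (hα : 0 ≤ α) (z : ℂ) :
    (α * z.re ^ 2 - z.im ^ 2) * (z.re ^ 2 + z.im ^ 2) ^ (p / 2 - 1) ≤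
      (α + 1) * (2 * (α + 1)) ^ (p / 2 - 1) * |z.re| ^ p - 1 / 2 * ‖z‖ ^ p := by
  have hs : p / 2 = p / 2 - 1 + 1 := by ring
  have hs0 : 0 ≤ p / 2 - 1 := by linarith
  have hn : 0 ≤ z.re ^ 2 + z.im ^ 2 := by positivity
  rw [norm_rpow_eq, abs_re_rpow_eq]
  nth_rw 4 [hs]
  nth_rw 3 [hs]
  rw [Real.rpow_add_one' hn (by linarith), Real.rpow_add_one' (sq_nonneg _) (by linarith)]
  set n := z.re ^ 2 + z.im ^ 2 with hnd
  have hns : 0 ≤ n ^ (p / 2 - 1) := by positivity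
  have hi : z.im ^ 2 = n - z.re ^ 2 := by rw [hnd]; ring
  rw [hi]
  rcases le_or_gt ((α + 1) * z.re ^ 2) (n / 2) with h | h
  · have h1 : 0 ≤ (α + 1) * (2 * (α + 1)) ^ (p / 2 - 1) *
        ((z.re ^ 2) ^ (p / 2 - 1) * z.re ^ 2) := by positivity
    have h2 := mul_le_mul_of_nonneg_right h hns
    linarith
  · have h1 : n ^ (p / 2 - 1) ≤ (2 * (α + 1)) ^ (p / 2 - 1) * (z.re ^ 2) ^ (p / 2 - 1) := by
      rw [← Real.mul_rpow (by positivity) (by positivity)]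
      exact Real.rpow_le_rpow hn (by linarith) hs0
    have h2 := mul_le_mul_of_nonneg_left h1 (show 0 ≤ (α + 1) * z.re ^ 2 by positivity)
    have h3 : 0 ≤ n ^ (p / 2 - 1) * n := by positivity
    linarith

theorem integral_rpow_le_of_two_le {p : ℝ} (hp : 2 ≤ p) :
    ∃ K, 0 < K ∧ ∀ F, IsDecayingEntire F →
      ∫ x : ℝ, ‖F x‖ ^ p ≤ K * ∫ x : ℝ, |(F x).re| ^ p := by
  have hs0 : 0 ≤ p / 2 - 1 := by linarith
  obtain ⟨α, hα⟩ : ∃ α : ℝ, α = 1 + 6 * (p / 2 - 1) + 2 * (p / 2 - 1) ^ 2 := ⟨_, rfl⟩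
  have hα0 : 0 ≤ α := by rw [hα]; positivity
  have hq : ∀ z : ℂ, |α * z.re ^ 2 - z.im ^ 2| ≤ (α + 1) * ‖z‖ ^ (2 : ℝ) := fun z => by
    rw [norm_rpow_eq, div_self two_ne_zero, Real.rpow_one, abs_le]
    have : 0 ≤ α * z.re ^ 2 := by positivity
    have : 0 ≤ α * z.im ^ 2 := by positivity
    constructor <;> nlinarith [sq_nonneg z.re, sq_nonneg z.im]
  refine ⟨(α + 1) * (2 * (α + 1)) ^ (p / 2 - 1) / (1 / 2), by positivity, fun F hF => ?_⟩
  have h0 := hF.integral_nonneg_of_tendsto (p := 2)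
    (Φ := fun δ z => (α * z.re ^ 2 - z.im ^ 2) * (z.re ^ 2 + z.im ^ 2 + δ) ^ (p / 2 - 1))
    (Ψ := fun z => (α * z.re ^ 2 - z.im ^ 2) * (z.re ^ 2 + z.im ^ 2) ^ (p / 2 - 1))
    (fun δ hδ => isSubharmonicFlat_of_nonneg hs0 hα hδ) one_lt_two
    (fun M => ⟨(α + 1) * (M ^ 2 + 1) ^ (p / 2 - 1), fun δ hδ hδ1 z hz => by
      have h1 : (z.re ^ 2 + z.im ^ 2 + δ) ^ (p / 2 - 1) ≤ (M ^ 2 + 1) ^ (p / 2 - 1) := by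
        refine Real.rpow_le_rpow (by positivity) ?_ hs0
        have : z.re ^ 2 + z.im ^ 2 = ‖z‖ ^ 2 := by
          rw [Complex.sq_norm, Complex.normSq_apply]; ring
        rw [this]
        gcongr
      rw [abs_mul, abs_of_nonneg (show 0 ≤ (z.re ^ 2 + z.im ^ 2 + δ) ^ (p / 2 - 1) by positivity)]
      calc _ ≤ ((α + 1) * ‖z‖ ^ (2 : ℝ)) * (M ^ 2 + 1) ^ (p / 2 - 1) := by
            gcongr
            exact hq z
        _ = _ := by ring⟩)
    (fun z => (tendsto_add_rpow _ hs0).const_mul _)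
  refine hF.integral_rpow_le_of_pointwise (by linarith) h0 (by norm_num)
    (mul_rpow_le_of_two_le hp hα0) ⟨α + 1, fun z => ?_⟩ ?_
  · rw [abs_mul, abs_of_nonneg (show 0 ≤ (z.re ^ 2 + z.im ^ 2) ^ (p / 2 - 1) by positivity)]
    have h1 : ‖z‖ ^ p = ‖z‖ ^ (2 : ℝ) * (z.re ^ 2 + z.im ^ 2) ^ (p / 2 - 1) := by
      rw [norm_rpow_eq, norm_rpow_eq, div_self two_ne_zero, Real.rpow_one, mul_comm,
        ← Real.rpow_add_one' (by positivity) (by linarith)]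
      ring_nf
    rw [h1, ← mul_assoc]
    gcongr
    exact hq z
  · refine Continuous.mul (by fun_prop) (Continuous.rpow_const (by fun_prop) fun x => Or.inr hs0)

theorem exists_integral_rpow_le {p : ℝ} (hp : 1 < p) :
    ∃ K, 0 < K ∧ ∀ F, IsDecayingEntire F →
      ∫ x : ℝ, ‖F x‖ ^ p ≤ K * ∫ x : ℝ, |(F x).re| ^ p := by
  rcases le_total p 2 with h | h
  · exact ⟨2 / (p - 1), div_pos two_pos (by linarith), fun F hF =>
      hF.integral_rpow_le_of_le_two hp h⟩
  · exact integral_rpow_le_of_two_le h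

theorem exists_eLpNorm_le {p : ℝ≥0∞} (hp : 1 < p) (hp' : p < ⊤) :
    ∃ K : ℝ, 0 < K ∧ ∀ F, IsDecayingEntire F →
      eLpNorm (fun x : ℝ => F x) p volume ≤
        ENNReal.ofReal K * eLpNorm (fun x : ℝ => (F x).re) p volume := by
  have hq : 1 < p.toReal := by
    rw [← ENNReal.toReal_one]
    exact (ENNReal.toReal_lt_toReal one_ne_top hp'.ne).2 hp
  have hp0 : p ≠ 0 := (zero_lt_one.trans hp).ne'
  obtain ⟨K, hK, h⟩ := exists_integral_rpow_le hq
  refine ⟨K ^ p.toReal⁻¹, by positivity, fun F hF => ?_⟩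
  have key : ∀ G : ℝ → ℝ, Integrable (fun x => |G x| ^ p.toReal) →
      (∫⁻ x, ‖G x‖ₑ ^ p.toReal) = ENNReal.ofReal (∫ x, |G x| ^ p.toReal) := fun G hG => by
    rw [ofReal_integral_eq_lintegral_ofReal hG (ae_of_all _ fun x => by positivity)]
    refine lintegral_congr fun x => ?_
    rw [← ENNReal.ofReal_rpow_of_nonneg (abs_nonneg _) (by linarith), ← Real.norm_eq_abs,
      ofReal_norm]
  have e1 := key (fun x => ‖F x‖) (by simpa using hF.integrable_norm_rpow hq)
  have e2 := key (fun x => (F x).re) (hF.integrable_re_rpow hq)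
  simp only [enorm_norm, abs_norm] at e1
  rw [eLpNorm_eq_lintegral_rpow_enorm_toReal hp0 hp'.ne,
    eLpNorm_eq_lintegral_rpow_enorm_toReal hp0 hp'.ne, e1, e2, one_div,
    ← ENNReal.ofReal_rpow_of_pos hK, ← ENNReal.mul_rpow_of_nonneg _ _ (by positivity),
    ← ENNReal.ofReal_mul hK.le]
  exact ENNReal.rpow_le_rpow (ENNReal.ofReal_le_ofReal (h F hF)) (by positivity)

end IsDecayingEntire

/-- The one-sided Fourier integral `∫₀ᴿ k(ξ) e^{2πiξz} dξ`. -/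
noncomputable def oneSided (R : ℝ) (k : ℝ → ℂ) (z : ℂ) : ℂ :=
  ∫ ξ in (0 : ℝ)..R, k ξ * Complex.exp (2 * Real.pi * Complex.I * ξ * z)

theorem norm_exp_oneSided_le {R ξ : ℝ} {z : ℂ} {t : ℝ} (h0 : 0 ≤ ξ) (hξ : ξ ≤ R) (ht : 0 ≤ t)
    (hz : -t ≤ z.im) :
    ‖Complex.exp (2 * Real.pi * Complex.I * ξ * z)‖ ≤ Real.exp (2 * Real.pi * R * t) := by
  rw [Complex.norm_exp]
  refine Real.exp_le_exp.2 ?_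
  have : (2 * Real.pi * Complex.I * ξ * z : ℂ).re = 2 * Real.pi * (ξ * -z.im) := by
    simp
    ring
  rw [this, mul_assoc (2 * Real.pi)]
  have h2 : ξ * -z.im ≤ ξ * t := by gcongr; linarith
  have h3 : ξ * t ≤ R * t := by gcongr
  exact mul_le_mul_of_nonneg_left (h2.trans h3) (by positivity)

theorem hasDerivAt_oneSided {R : ℝ} (hR : 0 ≤ R) {k : ℝ → ℂ} (hk : Continuous k) (z : ℂ) :
    HasDerivAt (oneSided R k) (oneSided R (fun ξ => 2 * Real.pi * Complex.I * ξ * k ξ) z) z := by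
  have hd : ∀ w (ξ : ℝ), HasDerivAt (fun w => k ξ * Complex.exp (2 * Real.pi * Complex.I * ξ * w))
      (2 * Real.pi * Complex.I * ξ * k ξ * Complex.exp (2 * Real.pi * Complex.I * ξ * w)) w :=
    fun w ξ => by
      have := ((((hasDerivAt_id w).const_mul (2 * Real.pi * Complex.I * ξ)).cexp).const_mul (k ξ))
      convert! this using 1
      simp
      ring
  have hc : ∀ (g : ℝ → ℂ) (w : ℂ), Continuous g →
      Continuous fun ξ : ℝ => g ξ * Complex.exp (2 * Real.pi * Complex.I * ξ * w) := by
    intro g w hg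
    fun_prop
  have hk1 : Continuous fun ξ : ℝ => 2 * Real.pi * Complex.I * ξ * k ξ := by fun_prop
  refine (intervalIntegral.hasDerivAt_integral_of_dominated_loc_of_deriv_le
    (F := fun w ξ => k ξ * Complex.exp (2 * Real.pi * Complex.I * ξ * w))
    (F' := fun w ξ => 2 * Real.pi * Complex.I * ξ * k ξ *
      Complex.exp (2 * Real.pi * Complex.I * ξ * w))
    (bound := fun ξ => ‖2 * Real.pi * Complex.I * ξ * k ξ‖ *
      Real.exp (2 * Real.pi * R * (‖z‖ + 1)))
    (Metric.ball_mem_nhds z one_pos) (Eventually.of_forall fun w => ?_) ?_ ?_ ?_ ?_ ?_).2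
  · exact (hc k w hk).aestronglyMeasurable
  · exact (hc k z hk).intervalIntegrable _ _
  · exact (hc _ z hk1).aestronglyMeasurable
  · refine ae_of_all _ fun ξ hξ w hw => ?_
    rw [uIoc_of_le hR] at hξ
    rw [norm_mul]
    gcongr
    refine norm_exp_oneSided_le hξ.1.le hξ.2 (by positivity) ?_
    have h1 := (abs_le.1 (Complex.abs_im_le_norm w)).1
    have h2 : ‖w‖ ≤ ‖z‖ + 1 := by
      have := norm_sub_norm_le w z
      rw [Metric.mem_ball, dist_eq_norm] at hw
      linarith
    linarith
  · exact (hk1.norm.mul continuous_const).intervalIntegrable _ _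
  · exact ae_of_all _ fun ξ _ w _ => hd w ξ

theorem exists_norm_oneSided_le {R : ℝ} (hR : 0 ≤ R) {k : ℝ → ℂ} (hk : ContDiff ℝ 1 k)
    (hkR : k R = 0) :
    ∃ C, ∀ z : ℂ, -1 ≤ z.im → ‖oneSided R k z‖ ≤ C / (1 + ‖z‖) := by
  have hk' : Continuous (deriv k) := hk.continuous_deriv le_rfl
  obtain ⟨M, hM⟩ := (isCompact_Icc (a := (0 : ℝ)) (b := R)).exists_bound_of_continuousOn
    hk.continuous.continuousOn
  obtain ⟨M', hM'⟩ := (isCompact_Icc (a := (0 : ℝ)) (b := R)).exists_bound_of_continuousOn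
    hk'.continuousOn
  have hM0 : 0 ≤ M := (norm_nonneg _).trans (hM 0 ⟨le_rfl, hR⟩)
  have hM0' : 0 ≤ M' := (norm_nonneg _).trans (hM' 0 ⟨le_rfl, hR⟩)
  set B := Real.exp (2 * Real.pi * R * 1) with hB
  have hint : ∀ (g : ℝ → ℂ) (N : ℝ), 0 ≤ N → (∀ ξ ∈ Icc 0 R, ‖g ξ‖ ≤ N) → ∀ z : ℂ, -1 ≤ z.im →
      ‖∫ ξ in (0 : ℝ)..R, g ξ * Complex.exp (2 * Real.pi * Complex.I * ξ * z)‖ ≤ N * B * R := by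
    intro g N hN hg z hz
    have := intervalIntegral.norm_integral_le_of_norm_le_const (a := 0) (b := R) (C := N * B)
      (f := fun ξ : ℝ => g ξ * Complex.exp (2 * Real.pi * Complex.I * ξ * z)) (fun ξ hξ => by
        rw [uIoc_of_le hR] at hξ
        rw [norm_mul]
        have := hg ξ ⟨hξ.1.le, hξ.2⟩
        have := norm_exp_oneSided_le hξ.1.le hξ.2 zero_le_one hz
        gcongr)
    rwa [sub_zero, abs_of_nonneg hR] at this
  refine ⟨M * B * R + (‖k 0‖ + M' * B * R), fun z hz => ?_⟩
  rw [le_div_iff₀ (by positivity), mul_add, mul_one]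
  refine add_le_add (hint k M hM0 hM z hz) ?_
  have hv : ∀ ξ : ℝ, HasDerivAt (fun ξ : ℝ => Complex.exp (2 * Real.pi * Complex.I * ξ * z))
      (2 * Real.pi * Complex.I * z * Complex.exp (2 * Real.pi * Complex.I * ξ * z)) ξ := fun ξ => by
    have := (((hasDerivAt_id ξ).ofReal_comp.const_mul (2 * Real.pi * Complex.I)).mul_const z).cexp
    convert! this using 1
    simp
    ring
  have hparts := intervalIntegral.integral_mul_deriv_eq_deriv_mul (a := 0) (b := R) (u := k)
    (u' := deriv k) (fun ξ _ => (hk.differentiable one_ne_zero ξ).hasDerivAt) (fun ξ _ => hv ξ)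
    (hk'.intervalIntegrable _ _) (Continuous.intervalIntegrable (by fun_prop) _ _)
  have hparts' : 2 * Real.pi * Complex.I * z * oneSided R k z =
      - k 0 - ∫ ξ in (0 : ℝ)..R, deriv k ξ * Complex.exp (2 * Real.pi * Complex.I * ξ * z) := by
    rw [hkR] at hparts
    simp only [zero_mul, Complex.ofReal_zero, mul_zero, Complex.exp_zero, mul_one,
      zero_sub] at hparts
    rw [← hparts, oneSided, ← intervalIntegral.integral_const_mul]
    exact intervalIntegral.integral_congr fun ξ _ => by ring
  have h1 : ‖2 * Real.pi * Complex.I * z * oneSided R k z‖ ≤ ‖k 0‖ + M' * B * R := by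
    rw [hparts']
    refine (norm_sub_le _ _).trans ?_
    rw [norm_neg]
    exact add_le_add_right (hint _ M' hM0' hM' z hz) _
  refine le_trans ?_ h1
  rw [norm_mul, norm_mul, mul_comm]
  have h2 : (1 : ℝ) ≤ ‖(2 * Real.pi * Complex.I : ℂ)‖ := by
    simp [abs_of_pos Real.pi_pos]
    linarith [Real.pi_gt_three]
  have h3 := le_mul_of_one_le_left (norm_nonneg z) h2
  gcongr

theorem isDecayingEntire_oneSided {R : ℝ} (hR : 0 ≤ R) {k : ℝ → ℂ} (hk : ContDiff ℝ 1 k)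
    (hkR : k R = 0) : IsDecayingEntire (oneSided R k) := by
  have hm : ∀ g : ℝ → ℂ, ContDiff ℝ 1 g →
      ContDiff ℝ 1 fun ξ : ℝ => 2 * Real.pi * Complex.I * ξ * g ξ := fun g hg =>
    (contDiff_const.mul Complex.ofRealCLM.contDiff).mul hg
  have hk1 := hm k hk
  have hk2 := hm _ hk1
  obtain ⟨C, hC⟩ := exists_norm_oneSided_le hR hk hkR
  obtain ⟨C₁, hC₁⟩ := exists_norm_oneSided_le hR hk1 (by simp [hkR])
  obtain ⟨C₂, hC₂⟩ := exists_norm_oneSided_le hR hk2 (by simp [hkR])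
  refine ⟨_, _, max C (max C₁ C₂), hasDerivAt_oneSided hR hk.continuous,
    hasDerivAt_oneSided hR hk1.continuous, continuous_iff_continuousAt.2 fun z =>
      (hasDerivAt_oneSided hR hk2.continuous z).continuousAt, fun z hz =>
      ⟨(hC z hz).trans ?_, (hC₁ z hz).trans ?_, (hC₂ z hz).trans ?_⟩⟩
  · gcongr; exact le_max_left _ _
  · gcongr; exact (le_max_left _ _).trans (le_max_right _ _)
  · gcongr; exact (le_max_right _ _).trans (le_max_right _ _)

/-- The Fourier integral `∫_s k(ξ) e^{2πiξx} dξ` over a set of frequencies. -/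
noncomputable def fourierOn (s : Set ℝ) (k : ℝ → ℂ) (x : ℝ) : ℂ :=
  ∫ ξ in s, k ξ * Complex.exp (2 * Real.pi * Complex.I * ξ * x)

theorem norm_exp_two_pi_mul_I (ξ x : ℝ) :
    ‖Complex.exp (2 * Real.pi * Complex.I * ξ * x)‖ = 1 := by
  rw [Complex.norm_exp]
  simp

theorem integrable_mul_exp {k : ℝ → ℂ} (hk : Integrable k) (x : ℝ) :
    Integrable fun ξ : ℝ => k ξ * Complex.exp (2 * Real.pi * Complex.I * ξ * x) := by
  refine hk.mul_bdd (c := 1) (Continuous.aestronglyMeasurable (by fun_prop))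
    (ae_of_all _ fun ξ => (norm_exp_two_pi_mul_I ξ x).le)

theorem oneSided_eq_fourierOn {R : ℝ} (hR : 0 ≤ R) {k : ℝ → ℂ} (hkR : ∀ ξ, R ≤ ‖ξ‖ → k ξ = 0)
    (x : ℝ) : oneSided R k x = fourierOn (Ioi 0) k x := by
  rw [oneSided, fourierOn, intervalIntegral.integral_of_le hR]
  refine (setIntegral_eq_of_subset_of_forall_sdiff_eq_zero measurableSet_Ioi
    (fun ξ h => h.1) fun ξ hξ => ?_).symm
  have h0 : (0 : ℝ) < ξ := hξ.1
  have : R ≤ ‖ξ‖ := by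
    rw [Real.norm_of_nonneg h0.le]
    by_contra! h
    exact hξ.2 ⟨h0, h.le⟩
  rw [hkR ξ this, zero_mul]

theorem fourierOn_univ_eq {k : ℝ → ℂ} (hk : Integrable k) (x : ℝ) :
    fourierOn univ k x = fourierOn (Ioi 0) k x +
      starRingEnd ℂ (fourierOn (Ioi 0) (fun ξ => starRingEnd ℂ (k (-ξ))) x) := by
  have h := integrable_mul_exp hk x
  rw [fourierOn, ← Iic_union_Ioi (a := (0 : ℝ)), setIntegral_union (Iic_disjoint_Ioi le_rfl)
    measurableSet_Ioi h.integrableOn h.integrableOn, add_comm, ← fourierOn, fourierOn, fourierOn,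
    ← integral_conj]
  congr 1
  rw [← neg_zero, ← integral_comp_neg_Ioi]
  simp only [neg_zero]
  refine integral_congr_ae (ae_of_all _ fun ξ => ?_)
  simp only [map_mul, Complex.conj_conj, ← Complex.exp_conj, Complex.conj_I, Complex.conj_ofReal,
    map_ofNat]
  push_cast
  ring_nf

theorem fourierOn_add {s : Set ℝ} {k l : ℝ → ℂ} (hk : Integrable k) (hl : Integrable l) (x : ℝ) :
    fourierOn s (fun ξ => k ξ + l ξ) x = fourierOn s k x + fourierOn s l x := by
  rw [fourierOn, fourierOn, fourierOn, ← integral_add (integrable_mul_exp hk x).integrableOn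
    (integrable_mul_exp hl x).integrableOn]
  simp only [add_mul]

theorem fourierOn_const_mul (s : Set ℝ) (c : ℂ) (k : ℝ → ℂ) (x : ℝ) :
    fourierOn s (fun ξ => c * k ξ) x = c * fourierOn s k x := by
  rw [fourierOn, fourierOn, ← integral_const_mul]
  simp only [mul_assoc]

theorem continuous_fourierOn (s : Set ℝ) {k : ℝ → ℂ} (hk : Integrable k) :
    Continuous (fourierOn s k) := by
  refine continuous_of_dominated (bound := fun ξ => ‖k ξ‖)
    (fun x => (integrable_mul_exp hk x).integrableOn.aestronglyMeasurable)
    (fun x => ae_of_all _ fun ξ => ?_) hk.norm.integrableOn (ae_of_all _ fun ξ => by fun_prop)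
  rw [norm_mul, norm_exp_two_pi_mul_I, mul_one]

theorem exists_eLpNorm_fourierOn_Ioi_zero_le {p : ℝ≥0∞} (hp : 1 < p) (hp' : p < ⊤) :
    ∃ K : ℝ, 0 < K ∧ ∀ k : ℝ → ℂ, ContDiff ℝ 1 k → HasCompactSupport k →
      eLpNorm (fourierOn (Ioi 0) k) p volume ≤
        ENNReal.ofReal K * eLpNorm (fourierOn univ k) p volume := by
  obtain ⟨K, hK, h⟩ := IsDecayingEntire.exists_eLpNorm_le hp hp'
  refine ⟨K + K, by positivity, fun k hk hkc => ?_⟩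
  have hki : Integrable k := hk.continuous.integrable_of_hasCompactSupport hkc
  obtain ⟨R, hR, hkR⟩ := hkc.exists_pos_le_norm
  set l : ℝ → ℂ := fun ξ => starRingEnd ℂ (k (-ξ)) with hl
  have hlc : ContDiff ℝ 1 l :=
    Complex.conjCLE.contDiff.comp (hk.comp contDiff_neg)
  have hlR : ∀ ξ, R ≤ ‖ξ‖ → l ξ = 0 := fun ξ hξ => by simp [hl, hkR (-ξ) (by simpa using hξ)]
  have hli : Integrable l := hlc.continuous.integrable_of_hasCompactSupport
    (HasCompactSupport.of_support_subset_isCompact (isCompact_closedBall 0 R) fun ξ hξ => by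
      rw [mem_closedBall_zero_iff]
      by_contra! h'
      exact hξ (hlR ξ h'.le))
  have key : ∀ c d : ℂ, (∀ u v : ℂ, |(c * u + d * starRingEnd ℂ v).re| ≤ ‖u + v‖) →
      eLpNorm (fourierOn (Ioi 0) fun ξ => c * k ξ + d * l ξ) p volume ≤
        ENNReal.ofReal K * eLpNorm (fourierOn univ k) p volume := by
    intro c d hcd
    have hR0 : ∀ ξ, R ≤ ‖ξ‖ → c * k ξ + d * l ξ = 0 := fun ξ hξ => by
      rw [hkR ξ hξ, hlR ξ hξ, mul_zero, mul_zero, add_zero]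
    have h1 := h _ (isDecayingEntire_oneSided hR.le (k := fun ξ => c * k ξ + d * l ξ)
      ((contDiff_const.mul hk).add (contDiff_const.mul hlc)) (hR0 R (le_abs_self R)))
    simp only [oneSided_eq_fourierOn hR.le hR0] at h1
    refine h1.trans ?_
    gcongr
    refine eLpNorm_mono fun x => ?_
    rw [fourierOn_add (hki.const_mul c) (hli.const_mul d), fourierOn_const_mul,
      fourierOn_const_mul, fourierOn_univ_eq hki]
    have := hcd (fourierOn (Ioi 0) k x) (starRingEnd ℂ (fourierOn (Ioi 0) l x))
    rwa [Complex.conj_conj] at this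
  have h1 := key (1 / 2) (1 / 2) fun u v => by
    have : (1 / 2 * u + 1 / 2 * starRingEnd ℂ v : ℂ).re = 1 / 2 * (u + v).re := by
      simp; ring
    rw [this, abs_mul, abs_of_pos one_half_pos]
    have := Complex.abs_re_le_norm (u + v)
    have := abs_nonneg (u + v).re
    linarith
  have h2 := key (-Complex.I / 2) (Complex.I / 2) fun u v => by
    have : (-Complex.I / 2 * u + Complex.I / 2 * starRingEnd ℂ v : ℂ).re = 1 / 2 * (u + v).im := by
      simp; ring
    rw [this, abs_mul, abs_of_pos one_half_pos]
    have := Complex.abs_im_le_norm (u + v)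
    have := abs_nonneg (u + v).im
    linarith
  have hi1 : Integrable fun ξ => (1 / 2 : ℂ) * k ξ + 1 / 2 * l ξ :=
    (hki.const_mul _).add (hli.const_mul _)
  have hi2 : Integrable fun ξ => (-Complex.I / 2 : ℂ) * k ξ + Complex.I / 2 * l ξ :=
    (hki.const_mul _).add (hli.const_mul _)
  have e : fourierOn (Ioi 0) k = fourierOn (Ioi 0) (fun ξ => 1 / 2 * k ξ + 1 / 2 * l ξ) +
      Complex.I • fourierOn (Ioi 0) (fun ξ => -Complex.I / 2 * k ξ + Complex.I / 2 * l ξ) := by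
    funext x
    rw [Pi.add_apply, Pi.smul_apply, smul_eq_mul, ← fourierOn_const_mul,
      ← fourierOn_add hi1 (hi2.const_mul _)]
    congr 1
    funext ξ
    have := Complex.I_mul_I
    linear_combination ((k ξ - l ξ) / 2) * this
  have hc1 := continuous_fourierOn (Ioi 0) hi1
  have hc2 := continuous_fourierOn (Ioi 0) hi2
  rw [e, ENNReal.ofReal_add hK.le hK.le, add_mul]
  refine (eLpNorm_add_le hc1.aestronglyMeasurable (hc2.const_smul _).aestronglyMeasurable
    hp.le).trans (add_le_add h1 ?_)
  rw [eLpNorm_const_smul, ← ofReal_norm, Complex.norm_I, ofReal_one, one_mul]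
  exact h2

theorem fourierOn_Ioi (k : ℝ → ℂ) (a x : ℝ) : fourierOn (Ioi a) k x =
    Complex.exp (2 * Real.pi * Complex.I * a * x) * fourierOn (Ioi 0) (fun ξ => k (ξ + a)) x := by
  rw [fourierOn, fourierOn, ← integral_const_mul, ← integral_indicator measurableSet_Ioi,
    ← integral_indicator measurableSet_Ioi, ← integral_add_right_eq_self _ a]
  refine integral_congr_ae (ae_of_all _ fun ξ => ?_)
  simp only [indicator, mem_Ioi, lt_add_iff_pos_left]
  congr 1
  rw [mul_left_comm, ← Complex.exp_add]
  push_cast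
  ring_nf

theorem fourierOn_univ_comp_add (k : ℝ → ℂ) (a x : ℝ) : fourierOn univ k x =
    Complex.exp (2 * Real.pi * Complex.I * a * x) * fourierOn univ (fun ξ => k (ξ + a)) x := by
  rw [fourierOn, fourierOn, ← integral_const_mul, setIntegral_univ, setIntegral_univ,
    ← integral_add_right_eq_self _ a]
  refine integral_congr_ae (ae_of_all _ fun ξ => ?_)
  simp only
  rw [mul_left_comm, ← Complex.exp_add]
  push_cast
  ring_nf

theorem exists_eLpNorm_fourierOn_Icc_le {p : ℝ≥0∞} (hp : 1 < p) (hp' : p < ⊤) :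
    ∃ K : ℝ, 0 < K ∧ ∀ k : ℝ → ℂ, ContDiff ℝ 1 k → HasCompactSupport k → ∀ a b : ℝ,
      eLpNorm (fourierOn (Icc a b) k) p volume ≤
        ENNReal.ofReal K * eLpNorm (fourierOn univ k) p volume := by
  obtain ⟨K, hK, h⟩ := exists_eLpNorm_fourierOn_Ioi_zero_le hp hp'
  refine ⟨K + K, by positivity, fun k hk hkc a b => ?_⟩
  have hki : Integrable k := hk.continuous.integrable_of_hasCompactSupport hkc
  have key : ∀ a : ℝ, eLpNorm (fourierOn (Ioi a) k) p volume ≤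
      ENNReal.ofReal K * eLpNorm (fourierOn univ k) p volume := fun a => by
    have h1 := h (fun ξ => k (ξ + a)) (hk.comp (contDiff_id.add contDiff_const))
      (hkc.comp_homeomorph (Homeomorph.addRight a))
    have e1 : eLpNorm (fourierOn (Ioi a) k) p volume =
        eLpNorm (fourierOn (Ioi 0) fun ξ => k (ξ + a)) p volume :=
      eLpNorm_congr_norm_ae (ae_of_all _ fun x => by
        rw [fourierOn_Ioi, norm_mul, norm_exp_two_pi_mul_I, one_mul])
    have e2 : eLpNorm (fourierOn univ k) p volume =
        eLpNorm (fourierOn univ fun ξ => k (ξ + a)) p volume :=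
      eLpNorm_congr_norm_ae (ae_of_all _ fun x => by
        rw [fourierOn_univ_comp_add k a, norm_mul, norm_exp_two_pi_mul_I, one_mul])
    rw [e1, e2]
    exact h1
  rcases lt_or_ge b a with hab | hab
  · have : fourierOn (Icc a b) k = 0 := by
      funext x
      rw [fourierOn, Icc_eq_empty hab.not_ge, setIntegral_empty, Pi.zero_apply]
    rw [this, eLpNorm_zero]
    exact zero_le
  · have e : fourierOn (Icc a b) k = fourierOn (Ioi a) k - fourierOn (Ioi b) k := by
      funext x
      have hi := integrable_mul_exp hki x
      rw [Pi.sub_apply, eq_sub_iff_add_eq, fourierOn, integral_Icc_eq_integral_Ioc, fourierOn,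
        fourierOn, ← setIntegral_union (Ioc_disjoint_Ioi le_rfl) measurableSet_Ioi hi.integrableOn
        hi.integrableOn, Ioc_union_Ioi_eq_Ioi hab]
    rw [e, ENNReal.ofReal_add hK.le hK.le, add_mul]
    exact (eLpNorm_sub_le (continuous_fourierOn _ hki).aestronglyMeasurable
      (continuous_fourierOn _ hki).aestronglyMeasurable hp.le).trans (add_le_add (key a) (key b))

open scoped FourierTransform ContDiff Convolution

theorem fourierOn_univ_eq_fourier_neg (k : ℝ → ℂ) (x : ℝ) : fourierOn univ k x = 𝓕 k (-x) := by
  rw [fourierOn, setIntegral_univ, Real.fourier_real_eq_integral_exp_smul]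
  refine integral_congr_ae (ae_of_all _ fun ξ => ?_)
  simp only [smul_eq_mul]
  rw [mul_comm]
  congr 2
  push_cast
  ring

theorem fourierOn_univ_eq_fourierInv (k : ℝ → ℂ) : fourierOn univ k = 𝓕⁻ k := by
  funext x
  rw [fourierOn_univ_eq_fourier_neg, Real.fourierInv_eq_fourier_neg]

theorem fourierOn_univ_indicator {s : Set ℝ} (hs : MeasurableSet s) (k : ℝ → ℂ) :
    fourierOn univ (s.indicator k) = fourierOn s k := by
  funext x
  rw [fourierOn, fourierOn, setIntegral_univ, ← integral_indicator hs]
  refine integral_congr_ae (ae_of_all _ fun ξ => ?_)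
  by_cases h : ξ ∈ s <;> simp [h]

theorem norm_fourierOn_univ_le (k : ℝ → ℂ) (x : ℝ) : ‖fourierOn univ k x‖ ≤ ∫ ξ, ‖k ξ‖ := by
  rw [fourierOn, setIntegral_univ]
  refine (norm_integral_le_integral_norm _).trans_eq ?_
  simp only [norm_mul, norm_exp_two_pi_mul_I, mul_one]

theorem norm_fourierOn_normed_convolution_le (φ : ContDiffBump (0 : ℝ)) {g : ℝ → ℂ}
    (hg : Integrable g) (x : ℝ) :
    ‖fourierOn univ (φ.normed volume ⋆[ContinuousLinearMap.lsmul ℝ ℝ, volume] g) x‖ ≤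
      ‖fourierOn univ g x‖ := by
  have hi : Integrable fun ξ => (φ.normed volume ξ : ℂ) := φ.integrable_normed.ofReal
  have e : (φ.normed volume ⋆[ContinuousLinearMap.lsmul ℝ ℝ, volume] g) =
      ((fun ξ => (φ.normed volume ξ : ℂ)) ⋆[ContinuousLinearMap.lsmul ℂ ℂ, volume] g) := by
    funext ξ
    simp [convolution_def]
  rw [e, fourierOn_univ_eq_fourier_neg, Real.fourier_smul_convolution_eq hi hg,
    ← fourierOn_univ_eq_fourier_neg, ← fourierOn_univ_eq_fourier_neg, smul_eq_mul, norm_mul]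
  refine mul_le_of_le_one_left (norm_nonneg _) ((norm_fourierOn_univ_le _ _).trans_eq ?_)
  simp only [Complex.norm_real, Real.norm_of_nonneg (φ.nonneg_normed _)]
  exact φ.integral_normed

theorem exists_smooth_approx_indicator {k : ℝ → ℂ} (hk : Continuous k) (hkc : HasCompactSupport k)
    (a b : ℝ) :
    ∃ (l : ℕ → ℝ → ℂ) (M R : ℝ), (∀ n, ContDiff ℝ ∞ (l n)) ∧ (∀ n ξ, ‖l n ξ‖ ≤ M) ∧
      (∀ n ξ, R ≤ ‖ξ‖ → l n ξ = 0) ∧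
      (∀ᵐ ξ, Tendsto (fun n => l n ξ) atTop (𝓝 ((Icc a b).indicator k ξ))) ∧
      ∀ n x, ‖fourierOn univ (l n) x‖ ≤ ‖fourierOn (Icc a b) k x‖ := by
  have hki : Integrable k := hk.integrable_of_hasCompactSupport hkc
  set g := (Icc a b).indicator k with hg
  have hgi : Integrable g := hki.indicator measurableSet_Icc
  obtain ⟨M, hM⟩ := hk.bounded_above_of_compact_support hkc
  obtain ⟨R, -, hR⟩ := hkc.exists_pos_le_norm
  have hgM : ∀ ξ, ‖g ξ‖ ≤ M := fun ξ => (norm_indicator_le_norm_self _ _).trans (hM ξ)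
  have hgR : ∀ ξ, R ≤ ‖ξ‖ → g ξ = 0 := fun ξ hξ => by
    simp only [hg, indicator_apply, hR ξ hξ, ite_self]
  let φ : ℕ → ContDiffBump (0 : ℝ) := fun n =>
    ⟨1 / ((n : ℝ) + 1) / 2, 1 / ((n : ℝ) + 1), by positivity,
      half_lt_self (by positivity)⟩
  have hφ : ∀ n, (φ n).rOut = 1 / ((n : ℝ) + 1) := fun n => rfl
  have hφ1 : ∀ n, (φ n).rOut ≤ 1 := fun n => by
    rw [hφ, div_le_one (by positivity)]
    linarith [n.cast_nonneg (α := ℝ)]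
  refine ⟨fun n => (φ n).normed volume ⋆[ContinuousLinearMap.lsmul ℝ ℝ, volume] g, 2 * M + M,
    R + 1, fun n => ?_, fun n ξ => ?_, fun n ξ hξ => ?_, ?_, fun n x => ?_⟩
  · exact (φ n).hasCompactSupport_normed.contDiff_convolution_left _ (φ n).contDiff_normed
      hgi.locallyIntegrable
  · have h := (φ n).dist_normed_convolution_le (μ := volume) (x₀ := ξ) (ε := 2 * M)
      hgi.aestronglyMeasurable (fun y _ => by
        rw [dist_eq_norm]
        linarith [norm_sub_le (g y) (g ξ), hgM y, hgM ξ])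
    rw [dist_eq_norm] at h
    refine (norm_le_norm_sub_add _ (g ξ)).trans (add_le_add h (hgM ξ))
  · have h0 : g ξ = 0 := hgR ξ (by linarith)
    refine ((φ n).normed_convolution_eq_right fun y hy => ?_).trans h0
    rw [h0]
    refine hgR y ?_
    rw [Metric.mem_ball, dist_eq_norm] at hy
    linarith [norm_sub_norm_le ξ y, norm_sub_rev ξ y, hφ1 n]
  · refine ContDiffBump.ae_convolution_tendsto_right_of_locallyIntegrable (K := 2) ?_
      (Eventually.of_forall fun n => ?_) hgi.locallyIntegrable
    · exact tendsto_one_div_add_atTop_nhds_zero_nat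
    · change 1 / ((n : ℝ) + 1) ≤ 2 * (1 / ((n : ℝ) + 1) / 2)
      linarith
  · rw [← fourierOn_univ_indicator measurableSet_Icc]
    exact norm_fourierOn_normed_convolution_le (φ n) hgi x

theorem FT_eq_fourier (f : ℝ → ℂ) : FT f = 𝓕 f := by
  funext ξ
  rw [FT, Real.fourier_real_eq_integral_exp_smul]
  refine integral_congr_ae (ae_of_all _ fun x => ?_)
  simp only [smul_eq_mul]
  congr 2
  push_cast
  ring

theorem MemP.contDiff_FT {f : ℝ → ℂ} (hf : MemP f) : ContDiff ℝ ∞ (FT f) := by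
  obtain ⟨⟨φ, rfl⟩, -⟩ := hf
  rw [FT_eq_fourier, ← SchwartzMap.fourier_coe]
  exact (𝓕 φ).smooth ⊤

theorem MemP.fourierOn_FT {f : ℝ → ℂ} (hf : MemP f) : fourierOn univ (FT f) = f := by
  obtain ⟨⟨φ, rfl⟩, -⟩ := hf
  rw [FT_eq_fourier, fourierOn_univ_eq_fourierInv, ← SchwartzMap.fourier_coe,
    ← SchwartzMap.fourierInv_coe, FourierTransform.fourierInv_fourier_eq]

theorem FT_fourierOn_univ {k : ℝ → ℂ} (hk : ContDiff ℝ ∞ k) (hkc : HasCompactSupport k) :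
    FT (fourierOn univ k) = k := by
  have e : k = ⇑(hkc.toSchwartzMap hk) := rfl
  rw [FT_eq_fourier, fourierOn_univ_eq_fourierInv, e, ← SchwartzMap.fourierInv_coe,
    ← SchwartzMap.fourier_coe, FourierTransform.fourier_fourierInv_eq]

theorem memP_fourierOn_univ {k : ℝ → ℂ} (hk : ContDiff ℝ ∞ k) (hkc : HasCompactSupport k) :
    MemP (fourierOn univ k) := by
  refine ⟨⟨𝓕⁻ (hkc.toSchwartzMap hk), ?_⟩, by rwa [FT_fourierOn_univ hk hkc]⟩
  rw [SchwartzMap.fourierInv_coe, fourierOn_univ_eq_fourierInv]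
  rfl

/-- A function in `𝒫(ℝ)` with its frequencies cut off to `[a, b]` is approximated by functions in
`𝒫(ℝ)` with controlled `Lᵖ` norm. -/
theorem exists_memP_approx_cutoff {p : ℝ≥0∞} (hp : 1 < p) (hp' : p < ⊤) :
    ∃ K : ℝ, 0 < K ∧ ∀ (f : ℝ → ℂ), MemP f → ∀ a b : ℝ, ∃ (h : ℕ → ℝ → ℂ) (M R : ℝ),
      (∀ n, MemP (h n)) ∧ (∀ n ξ, ‖FT (h n) ξ‖ ≤ M) ∧ (∀ n ξ, R ≤ ‖ξ‖ → FT (h n) ξ = 0) ∧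
      (∀ᵐ ξ, Tendsto (fun n => FT (h n) ξ) atTop (𝓝 ((Icc a b).indicator (FT f) ξ))) ∧
      ∀ n, eLpNorm (h n) p volume ≤ ENNReal.ofReal K * eLpNorm f p volume := by
  obtain ⟨K, hK, h⟩ := exists_eLpNorm_fourierOn_Icc_le hp hp'
  refine ⟨K, hK, fun f hf a b => ?_⟩
  have hk := hf.contDiff_FT
  obtain ⟨l, M, R, hl, hM, hR, hlim, hle⟩ := exists_smooth_approx_indicator hk.continuous hf.2 a b
  have hlc : ∀ n, HasCompactSupport (l n) := fun n =>
    HasCompactSupport.of_support_subset_isCompact (isCompact_closedBall 0 R) fun ξ hξ => by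
      rw [mem_closedBall_zero_iff]
      by_contra! h'
      exact hξ (hR n ξ h'.le)
  have hFT : ∀ n, FT (fourierOn univ (l n)) = l n := fun n => FT_fourierOn_univ (hl n) (hlc n)
  refine ⟨fun n => fourierOn univ (l n), M, R, fun n => memP_fourierOn_univ (hl n) (hlc n), ?_⟩
  simp only [hFT]
  refine ⟨hM, hR, hlim, fun n => (eLpNorm_mono (hle n)).trans ?_⟩
  have := h (FT f) (hk.of_le (by exact_mod_cast le_top)) hf.2 a b
  rwa [hf.fourierOn_FT] at this

theorem norm_mul_mul_le_indicator {u v : ℝ → ℂ} {M N R S : ℝ} (hu : ∀ ξ, ‖u ξ‖ ≤ M)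
    (hv : ∀ η, ‖v η‖ ≤ N) (hu0 : ∀ ξ, R ≤ ‖ξ‖ → u ξ = 0) (hv0 : ∀ η, S ≤ ‖η‖ → v η = 0)
    (m : ℝ × ℝ → ℂ) (ζ : ℝ × ℝ) :
    ‖u ζ.1 * v ζ.2 * m ζ‖ ≤ (Metric.closedBall 0 R ×ˢ Metric.closedBall 0 S).indicator
      (fun ζ => M * N * ‖m ζ‖) ζ := by
  have hM : 0 ≤ M := (norm_nonneg _).trans (hu 0)
  by_cases h : ζ ∈ (Metric.closedBall (0 : ℝ) R ×ˢ Metric.closedBall (0 : ℝ) S)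
  · rw [indicator_of_mem h, norm_mul, norm_mul]
    have := hu ζ.1
    have := hv ζ.2
    gcongr
  · rw [indicator_of_notMem h]
    rw [mem_prod, mem_closedBall_zero_iff, mem_closedBall_zero_iff, not_and_or, not_le,
      not_le] at h
    rcases h with h | h
    · simp [hu0 _ h.le]
    · simp [hv0 _ h.le]

theorem integrable_indicator_prod_closedBall {m : ℝ × ℝ → ℂ} (hm : LocallyIntegrable m volume)
    (c R S : ℝ) :
    Integrable ((Metric.closedBall (0 : ℝ) R ×ˢ Metric.closedBall (0 : ℝ) S).indicator
      fun ζ => c * ‖m ζ‖) := by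
  have hc := (isCompact_closedBall (0 : ℝ) R).prod (isCompact_closedBall (0 : ℝ) S)
  exact (integrable_indicator_iff hc.measurableSet).2
    ((hm.integrableOn_isCompact hc).norm.const_mul c)

theorem norm_exp_bilinear (ζ : ℝ × ℝ) (x : ℝ) :
    ‖Complex.exp ((2 * Real.pi * (ζ.1 + ζ.2) * x) * Complex.I)‖ = 1 := by
  rw [Complex.norm_exp]
  simp

theorem MemP.aestronglyMeasurable_mul {f g : ℝ → ℂ} (hf : MemP f) (hg : MemP g) {m : ℝ × ℝ → ℂ}
    (hm : LocallyIntegrable m volume) :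
    AEStronglyMeasurable fun ζ : ℝ × ℝ => FT f ζ.1 * FT g ζ.2 * m ζ :=
  (((hf.contDiff_FT.continuous.comp continuous_fst).mul
    (hg.contDiff_FT.continuous.comp continuous_snd)).aestronglyMeasurable).mul
    hm.aestronglyMeasurable

theorem continuous_exp_bilinear (x : ℝ) : Continuous fun ζ : ℝ × ℝ =>
    Complex.exp ((2 * Real.pi * (ζ.1 + ζ.2) * x) * Complex.I) := by
  fun_prop

theorem continuous_Bm {f g : ℝ → ℂ} (hf : MemP f) (hg : MemP g) {m : ℝ × ℝ → ℂ}
    (hm : LocallyIntegrable m volume) : Continuous (Bm m f g) := by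
  obtain ⟨M, hM⟩ := hf.contDiff_FT.continuous.bounded_above_of_compact_support hf.2
  obtain ⟨N, hN⟩ := hg.contDiff_FT.continuous.bounded_above_of_compact_support hg.2
  obtain ⟨R, -, hR⟩ := hf.2.exists_pos_le_norm
  obtain ⟨S, -, hS⟩ := hg.2.exists_pos_le_norm
  refine continuous_of_dominated (fun x => (hf.aestronglyMeasurable_mul hg hm).mul
    (continuous_exp_bilinear x).aestronglyMeasurable) (fun x => ae_of_all _ fun ζ => ?_)
    (integrable_indicator_prod_closedBall hm (M * N) R S) (ae_of_all _ fun ζ => by fun_prop)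
  rw [norm_mul, norm_exp_bilinear, mul_one]
  exact norm_mul_mul_le_indicator hM hN hR hS m ζ

theorem tendsto_Bm {f g : ℝ → ℂ} {u v : ℕ → ℝ → ℂ} {A B : Set ℝ} {m : ℝ × ℝ → ℂ}
    (hm : LocallyIntegrable m volume) (hu : ∀ n, MemP (u n)) (hv : ∀ n, MemP (v n))
    {M N R S : ℝ} (huM : ∀ n ξ, ‖FT (u n) ξ‖ ≤ M) (hvN : ∀ n ξ, ‖FT (v n) ξ‖ ≤ N)
    (huR : ∀ n ξ, R ≤ ‖ξ‖ → FT (u n) ξ = 0) (hvS : ∀ n ξ, S ≤ ‖ξ‖ → FT (v n) ξ = 0)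
    (hulim : ∀ᵐ ξ, Tendsto (fun n => FT (u n) ξ) atTop (𝓝 (A.indicator (FT f) ξ)))
    (hvlim : ∀ᵐ ξ, Tendsto (fun n => FT (v n) ξ) atTop (𝓝 (B.indicator (FT g) ξ))) (x : ℝ) :
    Tendsto (fun n => Bm m (u n) (v n) x) atTop (𝓝 (Bm ((A ×ˢ B).indicator m) f g x)) := by
  refine tendsto_integral_of_dominated_convergence _
    (fun n => ((hu n).aestronglyMeasurable_mul (hv n) hm).mul
      (continuous_exp_bilinear x).aestronglyMeasurable)
    (integrable_indicator_prod_closedBall hm (M * N) R S) (fun n => ae_of_all _ fun ζ => ?_) ?_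
  · rw [norm_mul, norm_exp_bilinear, mul_one]
    exact norm_mul_mul_le_indicator (huM n) (hvN n) (huR n) (hvS n) m ζ
  · have h1 : ∀ᵐ ζ : ℝ × ℝ, Tendsto (fun n => FT (u n) ζ.1) atTop
        (𝓝 (A.indicator (FT f) ζ.1)) := Measure.quasiMeasurePreserving_fst.ae hulim
    have h2 : ∀ᵐ ζ : ℝ × ℝ, Tendsto (fun n => FT (v n) ζ.2) atTop
        (𝓝 (B.indicator (FT g) ζ.2)) := Measure.quasiMeasurePreserving_snd.ae hvlim
    filter_upwards [h1, h2] with ζ h1 h2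
    have e : FT f ζ.1 * FT g ζ.2 * (A ×ˢ B).indicator m ζ =
        A.indicator (FT f) ζ.1 * B.indicator (FT g) ζ.2 * m ζ := by
      by_cases hA : ζ.1 ∈ A <;> by_cases hB : ζ.2 ∈ B <;> simp [indicator, hA, hB]
    rw [e]
    exact ((h1.mul h2).mul_const _).mul_const _

theorem exists_eLpNorm_Bm_indicator_le {p₁ p₂ : ℝ≥0∞} (hp₁ : 1 < p₁) (hp₁' : p₁ < ⊤)
    (hp₂ : 1 < p₂) (hp₂' : p₂ < ⊤) :
    ∃ K : ℝ, 0 < K ∧ ∀ (p₃ : ℝ≥0∞) (m : ℝ × ℝ → ℂ), LocallyIntegrable m volume → ∀ C : ℝ, 0 ≤ C →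
      (∀ f g : ℝ → ℂ, MemP f → MemP g → eLpNorm (Bm m f g) p₃ volume ≤
        ENNReal.ofReal C * eLpNorm f p₁ volume * eLpNorm g p₂ volume) → ∀ a b c d : ℝ,
      ∀ f g : ℝ → ℂ, MemP f → MemP g →
        eLpNorm (Bm ((Icc a b ×ˢ Icc c d).indicator m) f g) p₃ volume ≤
          ENNReal.ofReal (K * C) * eLpNorm f p₁ volume * eLpNorm g p₂ volume := by
  obtain ⟨K, hK, h⟩ := exists_memP_approx_cutoff hp₁ hp₁'
  obtain ⟨L, hL, h'⟩ := exists_memP_approx_cutoff hp₂ hp₂'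
  refine ⟨K * L, by positivity, fun p₃ m hm C hC hmC a b c d f g hf hg => ?_⟩
  obtain ⟨u, M, R, hu, huM, huR, hulim, hule⟩ := h f hf a b
  obtain ⟨v, N, S, hv, hvN, hvS, hvlim, hvle⟩ := h' g hg c d
  refine (Lp.eLpNorm_lim_le_liminf_eLpNorm
    (fun n => (continuous_Bm (hu n) (hv n) hm).aestronglyMeasurable) _
    (ae_of_all _ (tendsto_Bm hm hu hv huM hvN huR hvS hulim hvlim))).trans ?_
  refine (liminf_le_liminf (Eventually.of_forall fun n => ?_)).trans_eq (liminf_const _)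
  calc _ ≤ ENNReal.ofReal C * eLpNorm (u n) p₁ volume * eLpNorm (v n) p₂ volume :=
        hmC _ _ (hu n) (hv n)
    _ ≤ ENNReal.ofReal C * (ENNReal.ofReal K * eLpNorm f p₁ volume) *
        (ENNReal.ofReal L * eLpNorm g p₂ volume) := by
        gcongr
        exacts [hule n, hvle n]
    _ = _ := by
        rw [ENNReal.ofReal_mul (by positivity), ENNReal.ofReal_mul hK.le]
        ring

theorem stmt7 (p₁ p₂ : ℝ≥0∞) (hp₁ : 1 < p₁) (hp₁' : p₁ < ⊤) (hp₂ : 1 < p₂) (hp₂' : p₂ < ⊤) :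
    ∃ C : ℝ, 0 < C ∧ ∀ p₃ : ℝ≥0∞, 1 ≤ p₃ → ∀ m : ℝ × ℝ → ℂ,
      LocallyIntegrable m volume → IsBiMult p₁ p₂ p₃ m → ∀ a b c d : ℝ,
        IsBiMult p₁ p₂ p₃ ((Set.Icc a b ×ˢ Set.Icc c d).indicator m) ∧
        biNorm p₁ p₂ p₃ ((Set.Icc a b ×ˢ Set.Icc c d).indicator m) ≤
          C * biNorm p₁ p₂ p₃ m := by
  obtain ⟨K, hK, h⟩ := exists_eLpNorm_Bm_indicator_le hp₁ hp₁' hp₂ hp₂'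
  refine ⟨K, hK, fun p₃ _ m hm hmult a b c d => ?_⟩
  obtain ⟨C, hC, hmC⟩ := hmult
  refine ⟨⟨K * C, by positivity, h p₃ m hm C hC.le hmC a b c d⟩, ?_⟩
  rw [← div_le_iff₀' hK]
  refine le_csInf ⟨C, hC.le, hmC⟩ fun B hB => ?_
  rw [div_le_iff₀' hK]
  exact csInf_le ⟨0, fun _ hx => hx.1⟩
    ⟨mul_nonneg hK.le hB.1, h p₃ m hm B hB.1 hB.2 a b c d⟩
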